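/- Let k, n ∈ ℕ with 2^{k+1} ≤ n, write n = 2^{a_1} + ⋯ + 2^{a_r} with a_1 > ⋯ > a_r ≥ 0, let q be maximal with a_q ≥ k, and set n̄ = ∑_{i=1}^{q} 2^{a_i}. Then for every k-type τ of size ⌊n/2^k⌋ one has G_k(n; τ) = (∏_{j=q+1}^{r} 2^{a_j}) · G_k(n̄; τ), and in particular G_k(n) = (∏_{j=q+1}^{r} 2^{a_j}) · G_k(n̄). -/

import Mathlib

namespace OddSym

open scoped Classical

/-- Remove one box from a row of size `p` (as multisets of parts). -/
def removeBox (lam : Multiset ℕ) (p : ℕ) : Multiset ℕ :=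
  if p ≤ 1 then lam.erase p else (p - 1) ::ₘ lam.erase p

lemma removeBox_sum_lt {lam : Multiset ℕ} {p : ℕ} (hp : p ∈ lam) (h0 : 0 < p) :
    (removeBox lam p).sum < lam.sum := by
  have h : p + (lam.erase p).sum = lam.sum := by
    conv_rhs => rw [← Multiset.cons_erase hp]
    simp [Multiset.sum_cons]
  unfold removeBox
  split
  · omega
  · simp only [Multiset.sum_cons]
    omega

/-- The number of standard Young tableaux of shape `lam`
(equivalently, the degree of the irreducible character of the symmetric
group labelled by `lam`), defined via the branching rule. -/
def degSYT (lam : Multiset ℕ) : ℕ :=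
  if _h : lam = 0 then 1
  else ∑ p ∈ (lam.toFinset.filter (fun p => 0 < p)).attach, degSYT (removeBox lam p.1)
termination_by lam.sum
decreasing_by
  have hp := p.2
  simp only [Finset.mem_filter, Multiset.mem_toFinset] at hp
  exact removeBox_sum_lt hp.1 hp.2

/-- `lam` is an odd partition: all parts positive and the number of standard
Young tableaux of shape `lam` (= the character degree) is odd. -/
def OddP (lam : Multiset ℕ) : Prop :=
  (∀ x ∈ lam, 0 < x) ∧ Odd (degSYT lam)

/-- The parts of `lam` sorted in weakly decreasing order. -/
def descList (lam : Multiset ℕ) : List ℕ :=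
  (lam.sort (· ≤ ·)).reverse

/-- The beta-set (set of beta-numbers) of `lam` with `m` beads:
`{ lam_i + (m - i) : 1 ≤ i ≤ m }` where `lam` is padded with zero parts. -/
def betaSet (lam : Multiset ℕ) (m : ℕ) : Finset ℕ :=
  (Finset.range m).image (fun i => (descList lam).getD i 0 + (m - 1 - i))

/-- `mu` is obtained from `lam` by removing an `e`-hook: in some beta-set of
`lam` a beta-number `x` is replaced by `x - e` (which is not a beta-number). -/
def IsHookRemoval (e : ℕ) (lam mu : Multiset ℕ) : Prop :=
  (∀ x ∈ lam, 0 < x) ∧ (∀ x ∈ mu, 0 < x) ∧ 0 < e ∧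
  ∃ m x, Multiset.card lam ≤ m ∧ Multiset.card mu ≤ m ∧
    x ∈ betaSet lam m ∧ e ≤ x ∧ x - e ∉ betaSet lam m ∧
    betaSet mu m = insert (x - e) ((betaSet lam m).erase x)

/-- The map `f_k` : for an odd partition `lam` with `2^k ≤ |lam|`, the unique
odd partition obtained from `lam` by removing a `2^k`-hook (junk value `0` if
no such partition exists). -/
noncomputable def fkOp (k : ℕ) (lam : Multiset ℕ) : Multiset ℕ :=
  if h : ∃ mu, IsHookRemoval (2 ^ k) lam mu ∧ OddP mu then h.choose else 0

/-- The partition encoded by a finite beta-set: each bead contributes a part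
equal to the number of gaps below it. -/
def partOfBeta (S : Finset ℕ) : Multiset ℕ :=
  (S.val.map (fun b => b - (S.filter (fun a => a < b)).card)).filter (fun p => 0 < p)

/-- The 2-quotient `(lam_0, lam_1)` of `lam`, computed from a beta-set with an
even number of beads via the two runners of the 2-abacus. -/
def quot2 (lam : Multiset ℕ) : Multiset ℕ × Multiset ℕ :=
  (partOfBeta (((betaSet lam (2 * Multiset.card lam)).filter (fun b => b % 2 = 0)).image
      (fun b => b / 2)),
   partOfBeta (((betaSet lam (2 * Multiset.card lam)).filter (fun b => b % 2 = 1)).image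
      (fun b => b / 2)))

/-- The `e`-core of `lam`: push all beads of an `e`-abacus configuration for
`lam` up as far as possible. -/
def coreP (e : ℕ) (lam : Multiset ℕ) : Multiset ℕ :=
  partOfBeta ((Finset.range (e * (Multiset.card lam + e))).filter
    (fun x => x / e <
      ((betaSet lam (Multiset.card lam + e)).filter (fun b => b % e = x % e)).card))

/-- Row `k` of the 2-quotient tower of `lam`: row 0 is `[lam]`, and row `k+1`
replaces each entry of row `k` by its 2-quotient pair. -/
def towerRow : ℕ → Multiset ℕ → List (Multiset ℕ)
  | 0, lam => [lam]
  | (k + 1), lam => (towerRow k lam).flatMap (fun mu => [(quot2 mu).1, (quot2 mu).2])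

/-- `R_k^j(lam)`: the component of row `k` of the 2-quotient tower of `lam`
from which a `2^(j-k)`-hook is removed in the passage from `lam` to `f_j(lam)`;
it is characterized by: row `k` for `f_j(lam)` is obtained from row `k` for
`lam` by replacing this component by its image under `f_(j-k)`. -/
noncomputable def Rcomp (k j : ℕ) (lam : Multiset ℕ) : Multiset ℕ :=
  if h : ∃ s, s < 2 ^ k ∧
      towerRow k (fkOp j lam) =
        (towerRow k lam).set s (fkOp (j - k) ((towerRow k lam).getD s 0))
  then (towerRow k lam).getD h.choose 0 else 0


/-- `G_k(n)`, the number of odd partitions `lam` of `n` with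
`f_k(f_k(lam)) = f_(k+1)(lam)`. -/
noncomputable def Gnum (k n : ℕ) : ℕ :=
  {lam : Multiset ℕ | OddP lam ∧ lam.sum = n ∧
    fkOp k (fkOp k lam) = fkOp (k + 1) lam}.ncard

/-- `G_k(n; τ)`, the number of odd partitions of `n` of `k`-type `τ` with
`f_k(f_k(lam)) = f_(k+1)(lam)`. -/
noncomputable def GnumT (k n : ℕ) (τ : List ℕ) : ℕ :=
  {lam : Multiset ℕ | OddP lam ∧ lam.sum = n ∧
    (towerRow k lam).map Multiset.sum = τ ∧
    fkOp k (fkOp k lam) = fkOp (k + 1) lam}.ncard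

lemma descList_cons_of_forall_le {p : ℕ} {lam : Multiset ℕ} (h : ∀ x ∈ lam, x ≤ p) :
    descList (p ::ₘ lam) = p :: descList lam := by
  unfold descList
  have h1 : (p ::ₘ lam).sort (· ≤ ·) = lam.sort (· ≤ ·) ++ [p] := by
    refine List.Perm.eq_of_pairwise' (r := (· ≤ ·)) (Multiset.pairwise_sort _ _) ?_ ?_
    · rw [List.pairwise_append]
      refine ⟨Multiset.pairwise_sort _ _, by simp, ?_⟩
      intro a ha b hb
      simp only [List.mem_singleton] at hb
      subst hb
      exact h a (by simpa using ha)
    · rw [← Multiset.coe_eq_coe, Multiset.sort_eq, ← Multiset.coe_add, Multiset.sort_eq,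
        Multiset.coe_singleton, add_comm, Multiset.singleton_add]
  rw [h1]
  simp

lemma betaSet_zero (m : ℕ) : betaSet 0 m = Finset.range m := by
  ext y
  simp only [betaSet, descList, Multiset.sort_zero, Finset.mem_image, Finset.mem_range]
  constructor
  · rintro ⟨i, hi, rfl⟩
    simp; omega
  · intro hy
    exact ⟨m - 1 - y, by omega, by simp; omega⟩

lemma betaSet_cons {p m : ℕ} {lam : Multiset ℕ} (h : ∀ x ∈ lam, x ≤ p) :
    betaSet (p ::ₘ lam) (m + 1) = insert (p + m) (betaSet lam m) := by
  unfold betaSet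
  rw [descList_cons_of_forall_le h, Finset.range_add_one', Finset.image_insert, Finset.map_eq_image,
    Finset.image_image]
  congr 1
  refine Finset.image_congr fun i hi => ?_
  simp only [Finset.coe_range, Set.mem_Iio] at hi
  change (p :: descList lam).getD (i + 1) 0 + (m + 1 - 1 - (i + 1)) = _
  rw [List.getD_cons_succ]
  congr 1
  omega

lemma lt_of_mem_betaSet {p m : ℕ} {lam : Multiset ℕ} (h : ∀ x ∈ lam, x ≤ p) {y : ℕ}
    (hy : y ∈ betaSet lam m) : y < p + m := by
  simp only [betaSet, Finset.mem_image, Finset.mem_range] at hy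
  obtain ⟨i, hi, rfl⟩ := hy
  have : (descList lam).getD i 0 ≤ p := by
    by_cases hl : i < (descList lam).length
    · rw [List.getD_eq_getElem _ _ hl]
      apply h
      exact (by simp [descList] : ∀ x, x ∈ descList lam → x ∈ lam) _ (List.getElem_mem hl)
    · rw [List.getD_eq_default _ _ (by omega)]
      exact Nat.zero_le _
  omega

/-- The number of gaps of `S` below `b`. -/
def gaps (S : Finset ℕ) (b : ℕ) : ℕ := b - (S.filter (fun a => a < b)).card

lemma partOfBeta_eq (S : Finset ℕ) :
    partOfBeta S = (S.val.map (gaps S)).filter (fun p => 0 < p) := rfl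

lemma card_filter_lt_le (S : Finset ℕ) (b : ℕ) : (S.filter (fun a => a < b)).card ≤ b := by
  calc _ ≤ (Finset.range b).card := Finset.card_le_card (by intro x; simp)
    _ = b := by simp

lemma partOfBeta_pos (S : Finset ℕ) : ∀ x ∈ partOfBeta S, 0 < x := by
  intro x hx
  simp only [partOfBeta, Multiset.mem_filter] at hx
  exact hx.2

lemma card_partOfBeta_le (S : Finset ℕ) : Multiset.card (partOfBeta S) ≤ S.card := by
  refine (Multiset.card_le_card (Multiset.filter_le _ _)).trans ?_
  simp

lemma card_le_of_forall_lt {S : Finset ℕ} {M : ℕ} (h : ∀ x ∈ S, x < M) : S.card ≤ M := by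
  calc _ ≤ (Finset.range M).card := Finset.card_le_card (by intro x hx; simpa using h x hx)
    _ = M := by simp

lemma partOfBeta_insert {S : Finset ℕ} {M : ℕ} (h : ∀ x ∈ S, x < M) :
    partOfBeta (insert M S) =
      if S.card < M then (M - S.card) ::ₘ partOfBeta S else partOfBeta S := by
  have hM : M ∉ S := fun hm => lt_irrefl _ (h M hm)
  have h1 : (insert M S).filter (fun a => a < M) = S := by
    ext x
    simp only [Finset.mem_filter, Finset.mem_insert]
    constructor
    · rintro ⟨rfl | hx, hlt⟩
      · exact absurd hlt (lt_irrefl _)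
      · exact hx
    · exact fun hx => ⟨Or.inr hx, h x hx⟩
  have h2 : ∀ b ∈ S, (insert M S).filter (fun a => a < b) = S.filter (fun a => a < b) := by
    intro b hb
    rw [Finset.filter_insert, if_neg (by have := h b hb; omega)]
  have h3 : (insert M S).val.map (gaps (insert M S)) = (M - S.card) ::ₘ S.val.map (gaps S) := by
    rw [Finset.insert_val_of_notMem hM, Multiset.map_cons]
    congr 1
    · simp only [gaps, h1]
    · exact Multiset.map_congr rfl fun b hb => by simp only [gaps, h2 b hb]
  rw [partOfBeta_eq, h3]
  split_ifs with hc
  · rw [Multiset.filter_cons_of_pos _ (by omega), partOfBeta_eq]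
  · rw [Multiset.filter_cons_of_neg _ (by omega), partOfBeta_eq]

lemma partOfBeta_range (m : ℕ) : partOfBeta (Finset.range m) = 0 := by
  induction m with
  | zero => rfl
  | succ m ih =>
    rw [Finset.range_add_one, partOfBeta_insert (by simp)]
    simp [ih]

lemma exists_eq_cons_max {lam : Multiset ℕ} (h : lam ≠ 0) :
    ∃ p mu, lam = p ::ₘ mu ∧ ∀ x ∈ mu, x ≤ p := by
  obtain ⟨p, hp, hmax⟩ := lam.toFinset.exists_max_image id
    (by rw [Multiset.toFinset_nonempty]; exact h)
  rw [Multiset.mem_toFinset] at hp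
  refine ⟨p, lam.erase p, (Multiset.cons_erase hp).symm, fun x hx => ?_⟩
  exact hmax x (Multiset.mem_toFinset.2 (Multiset.mem_of_mem_erase hx))

lemma card_betaSet (lam : Multiset ℕ) (m : ℕ) (h : Multiset.card lam ≤ m) :
    (betaSet lam m).card = m := by
  induction m generalizing lam with
  | zero => simp [betaSet]
  | succ m ih =>
    by_cases h0 : lam = 0
    · rw [h0, betaSet_zero, Finset.card_range]
    · obtain ⟨p, mu, rfl, hp⟩ := exists_eq_cons_max h0
      rw [betaSet_cons hp, Finset.card_insert_of_notMem, ih]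
      · simpa using h
      · intro hm
        exact lt_irrefl _ (lt_of_mem_betaSet hp hm)

lemma partOfBeta_betaSet {lam : Multiset ℕ} (hpos : ∀ x ∈ lam, 0 < x) {m : ℕ}
    (h : Multiset.card lam ≤ m) : partOfBeta (betaSet lam m) = lam := by
  induction m generalizing lam with
  | zero =>
    have : lam = 0 := by simpa using h
    subst this
    rw [betaSet_zero, partOfBeta_range]
  | succ m ih =>
    by_cases h0 : lam = 0
    · rw [h0, betaSet_zero, partOfBeta_range]
    · obtain ⟨p, mu, rfl, hp⟩ := exists_eq_cons_max h0
      have hc : Multiset.card mu ≤ m := by simpa using h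
      have hp0 : 0 < p := hpos p (by simp)
      rw [betaSet_cons hp, partOfBeta_insert (fun x hx => lt_of_mem_betaSet hp hx),
        card_betaSet mu m hc, if_pos (by omega),
        ih (fun x hx => hpos x (Multiset.mem_cons_of_mem hx)) hc, Nat.add_sub_cancel]

lemma gaps_le_of_lt {S : Finset ℕ} {b c : ℕ} (h : b ≤ c) : gaps S b ≤ gaps S c := by
  have h1 : (S.filter (fun a => a < c)).card ≤ (S.filter (fun a => a < b)).card + (c - b) := by
    calc _ ≤ (S.filter (fun a => a < b) ∪ Finset.Ico b c).card :=
          Finset.card_le_card fun x => by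
            simp only [Finset.mem_filter, Finset.mem_union, Finset.mem_Ico]
            intro hx
            by_cases hxb : x < b
            · exact Or.inl ⟨hx.1, hxb⟩
            · exact Or.inr ⟨by omega, hx.2⟩
      _ ≤ _ := (Finset.card_union_le _ _).trans (by simp)
  have h2 := card_filter_lt_le S b
  unfold gaps
  omega

lemma betaSet_partOfBeta (S : Finset ℕ) : betaSet (partOfBeta S) S.card = S := by
  induction S using Finset.induction_on_max with
  | empty => rfl
  | insert M S h ih =>
    have hM : M ∉ S := fun hm => lt_irrefl _ (h M hm)
    have hle := card_le_of_forall_lt h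
    rw [Finset.card_insert_of_notMem hM, partOfBeta_insert h]
    split_ifs with hc
    · rw [betaSet_cons, ih, Nat.sub_add_cancel hle]
      intro x hx
      simp only [partOfBeta_eq, Multiset.mem_filter, Multiset.mem_map, Finset.mem_val] at hx
      obtain ⟨⟨b, hb, rfl⟩, -⟩ := hx
      have h1 : S.filter (fun a => a < M) = S := Finset.filter_true_of_mem h
      have := gaps_le_of_lt (S := S) (h b hb).le
      simpa only [gaps, h1] using this
    · have hS : S = Finset.range M := by
        apply Finset.eq_of_subset_of_card_le
        · intro x hx; simpa using h x hx
        · simp; omega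
      have hcard : S.card = M := by rw [hS, Finset.card_range]
      rw [hcard, hS, partOfBeta_range, betaSet_zero, Finset.range_add_one]

lemma sum_partOfBeta (S : Finset ℕ) :
    (partOfBeta S).sum + ∑ i ∈ Finset.range S.card, i = ∑ x ∈ S, x := by
  induction S using Finset.induction_on_max with
  | empty => rfl
  | insert M S h ih =>
    have hM : M ∉ S := fun hm => lt_irrefl _ (h M hm)
    have hle := card_le_of_forall_lt h
    rw [Finset.card_insert_of_notMem hM, partOfBeta_insert h, Finset.sum_insert hM,
      Finset.sum_range_succ, ← ih]
    split_ifs with hc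
    · rw [Multiset.sum_cons]; omega
    · omega

lemma partOfBeta_injective {S T : Finset ℕ} (hc : S.card = T.card)
    (h : partOfBeta S = partOfBeta T) : S = T := by
  rw [← betaSet_partOfBeta S, h, hc, betaSet_partOfBeta]

/-- The beads of `S` which can be moved down by `e` to an empty position. -/
def moves (e : ℕ) (S : Finset ℕ) : Finset ℕ := S.filter (fun x => e ≤ x ∧ x - e ∉ S)

/-- Move the bead `x` of `S` down by `e`. -/
def mv (e : ℕ) (S : Finset ℕ) (x : ℕ) : Finset ℕ := insert (x - e) (S.erase x)

lemma mem_moves {e x : ℕ} {S : Finset ℕ} : x ∈ moves e S ↔ x ∈ S ∧ e ≤ x ∧ x - e ∉ S := by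
  simp [moves]

lemma mem_mv {e x y : ℕ} {S : Finset ℕ} : y ∈ mv e S x ↔ y = x - e ∨ (y ≠ x ∧ y ∈ S) := by
  simp [mv]

lemma card_mv {e x : ℕ} {S : Finset ℕ} (h : x ∈ moves e S) : (mv e S x).card = S.card := by
  rw [mem_moves] at h
  rw [mv, Finset.card_insert_of_notMem (by simp [h.2.2]), Finset.card_erase_add_one h.1]

lemma sum_partOfBeta_mv {e x : ℕ} {S : Finset ℕ} (h : x ∈ moves e S) :
    (partOfBeta (mv e S x)).sum + e = (partOfBeta S).sum := by
  have h1 := sum_partOfBeta S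
  have h2 := sum_partOfBeta (mv e S x)
  rw [card_mv h] at h2
  rw [mem_moves] at h
  have h3 : ∑ i ∈ mv e S x, i + e = ∑ i ∈ S, i := by
    rw [mv, Finset.sum_insert (by simp [h.2.2]), ← Finset.add_sum_erase S (fun i => i) h.1]
    omega
  omega

lemma mv_injOn {e : ℕ} {S : Finset ℕ} (he : 0 < e) {x y : ℕ} (hx : x ∈ moves e S)
    (h : mv e S x = mv e S y) : x = y := by
  by_contra hne
  rw [mem_moves] at hx
  have h1 : x ∈ mv e S y := mem_mv.2 (Or.inr ⟨hne, hx.1⟩)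
  rw [← h, mem_mv] at h1
  rcases h1 with h1 | h1
  · omega
  · exact h1.1 rfl

lemma gaps_pos_of_mem_moves {S : Finset ℕ} {x : ℕ} (h : x ∈ moves 1 S) : 0 < gaps S x := by
  rw [mem_moves] at h
  have : (S.filter (fun a => a < x)).card ≤ x - 1 := by
    calc _ ≤ (Finset.range (x - 1)).card := Finset.card_le_card fun y => by
            simp only [Finset.mem_filter, Finset.mem_range]
            intro hy
            have : y ≠ x - 1 := fun hh => h.2.2 (hh ▸ hy.1)
            omega
      _ = _ := by simp
  unfold gaps
  omega

lemma gaps_lt_of_lt {S : Finset ℕ} {x y : ℕ} (h : y ∈ moves 1 S) (hxy : x < y) :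
    gaps S x < gaps S y := by
  rw [mem_moves] at h
  have h1 : (S.filter (fun a => a < y)).card ≤
      (S.filter (fun a => a < x)).card + (y - 1 - x) := by
    calc _ ≤ (S.filter (fun a => a < x) ∪ Finset.Ico x (y - 1)).card :=
          Finset.card_le_card fun z => by
            simp only [Finset.mem_filter, Finset.mem_union, Finset.mem_Ico]
            intro hz
            have : z ≠ y - 1 := fun hh => h.2.2 (hh ▸ hz.1)
            by_cases hzb : z < x
            · exact Or.inl ⟨hz.1, hzb⟩
            · exact Or.inr (by omega)
      _ ≤ _ := (Finset.card_union_le _ _).trans (by simp)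
  have h2 := card_filter_lt_le S x
  unfold gaps
  omega

lemma partOfBeta_mv_one {S : Finset ℕ} {x : ℕ} (h : x ∈ moves 1 S) :
    partOfBeta (mv 1 S x) = removeBox (partOfBeta S) (gaps S x) := by
  have hp := gaps_pos_of_mem_moves h
  have hm := mem_moves.1 h
  have hS : S = insert x (S.erase x) := (Finset.insert_erase hm.1).symm
  have hlt : ∀ b, b ≠ x → (mv 1 S x).filter (fun a => a < b) =
      if x < b then insert (x - 1) ((S.filter (fun a => a < b)).erase x)
      else S.filter (fun a => a < b) := by
    intro b hb
    ext z
    split_ifs with hxb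
    · simp only [Finset.mem_filter, mem_mv, Finset.mem_insert, Finset.mem_erase]
      have : x - 1 < b := by omega
      constructor
      · rintro ⟨rfl | hz, hzb⟩
        · exact Or.inl rfl
        · exact Or.inr ⟨hz.1, hz.2, hzb⟩
      · rintro (rfl | hz)
        · exact ⟨Or.inl rfl, this⟩
        · exact ⟨Or.inr ⟨hz.1, hz.2.1⟩, hz.2.2⟩
    · simp only [Finset.mem_filter, mem_mv]
      by_cases hbx : b = x - 1 + 1
      · omega
      · constructor
        · rintro ⟨rfl | hz, hzb⟩
          · omega
          · exact ⟨hz.2, hzb⟩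
        · rintro ⟨hz, hzb⟩
          exact ⟨Or.inr ⟨by omega, hz⟩, hzb⟩
  have hg : ∀ b ∈ S.erase x, gaps (mv 1 S x) b = gaps S b := by
    intro b hb
    have hbx := Finset.ne_of_mem_erase hb
    unfold gaps
    rw [hlt b hbx]
    split_ifs with hxb
    · congr 1
      rw [Finset.card_insert_of_notMem (by simp [hm.2.2]), Finset.card_erase_add_one]
      simp [hm.1, hxb]
    · rfl
  have hgx : gaps (mv 1 S x) (x - 1) = gaps S x - 1 := by
    unfold gaps
    rw [hlt (x - 1) (by omega), if_neg (by omega)]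
    have : S.filter (fun a => a < x - 1) = S.filter (fun a => a < x) := by
      apply Finset.filter_congr
      intro z hz
      have : z ≠ x - 1 := fun hh => hm.2.2 (hh ▸ hz)
      omega
    rw [this]
    omega
  have e1 : partOfBeta (mv 1 S x) = ((gaps S x - 1) ::ₘ (S.erase x).val.map (gaps S)).filter
      (fun p => 0 < p) := by
    rw [partOfBeta_eq]
    congr 1
    conv_lhs => rw [mv]
    rw [Finset.insert_val_of_notMem (by simp [hm.2.2]), Multiset.map_cons, ← mv, hgx]
    congr 1
    exact Multiset.map_congr rfl hg
  have e2 : (partOfBeta S).erase (gaps S x) =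
      ((S.erase x).val.map (gaps S)).filter (fun p => 0 < p) := by
    have : S.val.map (gaps S) = gaps S x ::ₘ (S.erase x).val.map (gaps S) := by
      conv_lhs => rw [hS, Finset.insert_val_of_notMem (by simp), Multiset.map_cons, ← hS]
    rw [partOfBeta_eq, this, Multiset.filter_cons_of_pos _ hp, Multiset.erase_cons_head]
  rw [e1, removeBox, e2]
  split_ifs with h1
  · rw [Multiset.filter_cons_of_neg _ (by omega)]
  · rw [Multiset.filter_cons_of_pos _ (by omega)]

lemma degSYT_partOfBeta {S : Finset ℕ} (h : partOfBeta S ≠ 0) :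
    degSYT (partOfBeta S) = ∑ x ∈ moves 1 S, degSYT (partOfBeta (mv 1 S x)) := by
  rw [degSYT, dif_neg h, Finset.sum_attach _ (fun p => degSYT (removeBox (partOfBeta S) p))]
  symm
  refine Finset.sum_nbij (gaps S) ?_ ?_ ?_ ?_
  · intro x hx
    have := gaps_pos_of_mem_moves hx
    simp only [Finset.mem_filter, Multiset.mem_toFinset, partOfBeta_eq, Multiset.mem_filter,
      Multiset.mem_map, Finset.mem_val]
    exact ⟨⟨⟨x, (mem_moves.1 hx).1, rfl⟩, this⟩, this⟩
  · intro x hx y hy hxy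
    rcases lt_trichotomy x y with h1 | h1 | h1
    · have := gaps_lt_of_lt hy h1
      omega
    · exact h1
    · have := gaps_lt_of_lt hx h1
      omega
  · intro p hp
    simp only [Finset.coe_filter, Multiset.mem_toFinset, partOfBeta_eq, Multiset.mem_filter,
      Multiset.mem_map, Finset.mem_val, Set.mem_ofPred_eq] at hp
    obtain ⟨⟨hex, hp0⟩, -⟩ := hp
    have hfind := Nat.find_spec hex
    have hmin := fun m hm => Nat.find_min hex (m := m) hm
    set x := Nat.find hex
    refine ⟨x, ?_, hfind.2⟩
    have hx0 : 0 < x := by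
      have := hfind.2
      unfold gaps at this
      omega
    rw [Finset.mem_coe, mem_moves]
    refine ⟨hfind.1, hx0, fun hx1 => hmin (x - 1) (by omega) ⟨hx1, ?_⟩⟩
    rw [← hfind.2]
    have : S.filter (fun a => a < x) = insert (x - 1) (S.filter (fun a => a < x - 1)) := by
      ext z
      simp only [Finset.mem_filter, Finset.mem_insert]
      constructor
      · intro hz
        by_cases hzx : z = x - 1
        · exact Or.inl hzx
        · exact Or.inr ⟨hz.1, by omega⟩
      · rintro (rfl | hz)
        · exact ⟨hx1, by omega⟩
        · exact ⟨hz.1, by omega⟩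
    unfold gaps
    rw [this, Finset.card_insert_of_notMem (by simp)]
    omega
  · intro x hx
    rw [partOfBeta_mv_one hx]

lemma sum_moves_moves (e : ℕ) (he : 0 < e) (S : Finset ℕ) (g : Finset ℕ → ZMod 2) :
    ∑ x ∈ moves e S, ∑ y ∈ moves e (mv e S x), g (mv e (mv e S x) y) =
      ∑ z ∈ moves (2 * e) S, g (mv (2 * e) S z) := by
  rw [Finset.sum_sigma', ← Finset.sum_filter_add_sum_filter_not _ (fun p => p.2 ∈ moves e S)]
  have hcancel : ∑ p ∈ ((moves e S).sigma fun x => moves e (mv e S x)).filter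
      (fun p => p.2 ∈ moves e S), g (mv e (mv e S p.1) p.2) = 0 := by
    refine Finset.sum_involution (fun p _ => ⟨p.2, p.1⟩) ?_ ?_ ?_ ?_
    · rintro ⟨x, y⟩ hp
      simp only [Finset.mem_filter, Finset.mem_sigma, mem_moves, mem_mv] at hp
      have : mv e (mv e S x) y = mv e (mv e S y) x := by
        ext z
        simp only [mem_mv]
        grind
      rw [this]
      exact CharTwo.add_self_eq_zero _
    · rintro ⟨x, y⟩ hp - heq
      simp only [Finset.mem_filter, Finset.mem_sigma, mem_moves, mem_mv, Sigma.mk.injEq,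
        heq_eq_eq] at hp heq
      grind
    · rintro ⟨x, y⟩ hp
      simp only [Finset.mem_filter, Finset.mem_sigma, mem_moves, mem_mv] at hp ⊢
      grind
    · rintro ⟨x, y⟩ hp
      rfl
  rw [hcancel, zero_add]
  symm
  refine Finset.sum_bij (fun z _ => if z - e ∈ S then ⟨z - e, z⟩ else ⟨z, z - e⟩) ?_ ?_ ?_ ?_
  · intro z hz
    simp only [mem_moves] at hz
    split_ifs <;> simp only [Finset.mem_filter, Finset.mem_sigma, mem_moves, mem_mv] <;> grind
  · intro z hz w hw h
    simp only [mem_moves] at hz hw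
    split_ifs at h <;> simp only [Sigma.mk.injEq, heq_eq_eq] at h <;> grind
  · rintro ⟨x, y⟩ hp
    simp only [Finset.mem_filter, Finset.mem_sigma, mem_moves, mem_mv] at hp
    by_cases hy : y ∈ S
    · refine ⟨y, ?_, ?_⟩
      · simp only [mem_moves]; grind
      · have : y - e = x := by grind
        have hx := hp.1.1.1
        rw [← this] at hx
        rw [if_pos hx, this]
    · refine ⟨x, ?_, ?_⟩
      · simp only [mem_moves]; grind
      · have : y = x - e := by grind
        rw [if_neg (by grind), this]
  · intro z hz
    simp only [mem_moves] at hz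
    congr 1
    split_ifs <;> (ext w; simp only [mem_mv]; grind)

/-- The parity of the number of standard tableaux of the partition encoded by `S`. -/
def parity (S : Finset ℕ) : ZMod 2 := (degSYT (partOfBeta S) : ZMod 2)

lemma parity_eq_sum_moves (j : ℕ) (S : Finset ℕ) (h : 2 ^ j ≤ (partOfBeta S).sum) :
    parity S = ∑ x ∈ moves (2 ^ j) S, parity (mv (2 ^ j) S x) := by
  induction j generalizing S with
  | zero =>
    have h0 : partOfBeta S ≠ 0 := by
      intro h0; rw [h0] at h; simp at h
    unfold parity
    rw [degSYT_partOfBeta h0, pow_zero]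
    push_cast
    rfl
  | succ j ih =>
    rw [pow_succ] at h
    rw [pow_succ', ← sum_moves_moves _ (by positivity), ih S (by omega)]
    refine Finset.sum_congr rfl fun x hx => ih _ ?_
    have := sum_partOfBeta_mv hx
    omega

lemma moves_subsingleton {e : ℕ} {S : Finset ℕ} (hS : (partOfBeta S).sum < 2 * e)
    {x y : ℕ} (hx : x ∈ moves e S) (hy : y ∈ moves e S) : x = y := by
  by_contra hne
  have hy' : y ∈ moves e (mv e S x) := by
    simp only [mem_moves, mem_mv] at *
    grind
  have h1 := sum_partOfBeta_mv hx
  have h2 := sum_partOfBeta_mv hy'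
  omega

lemma not_mem_moves_of_sum_lt {e : ℕ} {S : Finset ℕ} (hS : (partOfBeta S).sum < e) (x : ℕ) :
    x ∉ moves e S := by
  intro hx
  have h1 := sum_partOfBeta_mv hx
  omega

/-- If `S` has a unique `e`-hook `x`, then removing an `h`-hook `z` followed by an `e`-hook agrees
with removing `x` followed by an `h`-hook `w`, and `w` determines `z`. -/
lemma exists_commuting_move {e h x z u : ℕ} {S : Finset ℕ} (hh : 0 < h) (hhe : h < e)
    (hx : x ∈ moves e S) (hS : (partOfBeta (mv e S x)).sum < e)
    (hz : z ∈ moves h S) (hu : u ∈ moves e (mv h S z)) :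
    ∃ w ∈ moves h (mv e S x), mv h (mv e S x) w = mv e (mv h S z) u ∧
      z = if w = x - e then x else if w = x + h then x - e + h else w := by
  have hs := sum_partOfBeta_mv hx
  have H1 : ∀ y, y ∈ S → e ≤ y → y - e ∉ S → y = x := fun y h1 h2 h3 =>
    moves_subsingleton (by omega) (mem_moves.2 ⟨h1, h2, h3⟩) hx
  have H2 : ∀ q, (q = x - e ∨ (q ≠ x ∧ q ∈ S)) → e + h ≤ q →
      (q - (e + h) = x - e ∨ (q - (e + h) ≠ x ∧ q - (e + h) ∈ S)) := by
    intro q hq hle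
    by_contra hn
    exact not_mem_moves_of_sum_lt (e := e + h) (by omega) q
      (mem_moves.2 ⟨mem_mv.2 hq, hle, by rwa [mem_mv]⟩)
  simp only [mem_moves, mem_mv] at hx hz hu
  obtain ⟨hx1, hx2, hx3⟩ := hx
  obtain ⟨hz1, hz2, hz3⟩ := hz
  obtain ⟨hu1, hu2, hu3⟩ := hu
  obtain ⟨x, rfl⟩ := Nat.exists_eq_add_of_le' hx2
  obtain ⟨z, rfl⟩ := Nat.exists_eq_add_of_le' hz2
  obtain ⟨u, rfl⟩ := Nat.exists_eq_add_of_le' hu2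
  have K1 := H1 (u + e)
  have K2 := H1 (z + h)
  have K3 := H2 (z + h)
  have K4 := H2 (u + e)
  simp only [Nat.add_sub_cancel] at *
  clear H1 H2 hs hS
  by_cases huz : u + e = z
  · subst huz
    have e1 : u + e + h - e = u + h := by omega
    have e2 : u + e + h - (e + h) = u := by omega
    rw [e1] at K2
    rw [e2] at K3
    clear K1 K4
    have hze : u + h ∉ S := by
      intro hze
      have : u + e + h ≠ x + e := by
        intro hc
        exact hx3 (by rwa [show x = u + h by omega])
      grind
    have hzx : u + h = x := by
      have := K2 hz1 (by omega) hze
      omega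
    subst hzx
    refine ⟨u + h, ?_, ?_, ?_⟩
    · simp only [mem_moves, mem_mv, Nat.add_sub_cancel]; grind
    · ext t; simp only [mem_mv, Nat.add_sub_cancel]; grind
    · rw [if_pos rfl]; omega
  · have huS : u + e ∈ S := by grind
    by_cases hue : u ∈ S
    · have hzu : z + h = u := by grind
      subst hzu
      have e1 : z + h + e - (e + h) = z := by omega
      rw [e1] at K4
      have hux : z = x := by grind
      subst hux
      refine ⟨z + h + e, ?_, ?_, ?_⟩
      · simp only [mem_moves, mem_mv, show z + h + e - h = z + e by omega]; grind
      · ext t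
        simp only [mem_mv, Nat.add_sub_cancel, show z + h + e - h = z + e by omega]
        grind
      · rw [if_neg (by omega), if_pos (by omega)]
    · have hux : u = x := by
        have := K1 huS (by omega) hue
        omega
      subst hux
      refine ⟨z + h, ?_, ?_, ?_⟩
      · simp only [mem_moves, mem_mv, Nat.add_sub_cancel]; grind
      · ext t; simp only [mem_mv, Nat.add_sub_cancel]; grind
      · rw [if_neg (by grind), if_neg (by grind)]

lemma zmod_two_eq_one {a : ZMod 2} (h : a ≠ 0) : a = 1 := by
  revert a; decide

lemma exists_move_of_parity {S : Finset ℕ} (hS : parity S = 1) {j : ℕ}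
    (hj : 2 ^ j ≤ (partOfBeta S).sum) :
    ∃ x ∈ moves (2 ^ j) S, parity (mv (2 ^ j) S x) = 1 := by
  rw [parity_eq_sum_moves j S hj] at hS
  obtain ⟨x, hx, hne⟩ := Finset.exists_ne_zero_of_sum_ne_zero (hS.trans_ne one_ne_zero)
  exact ⟨x, hx, zmod_two_eq_one hne⟩

lemma move_unique_of_parity {S : Finset ℕ} (hS : parity S = 1) {j : ℕ}
    (hj : 2 ^ j ≤ (partOfBeta S).sum) {z z' : ℕ} (hz : z ∈ moves (2 ^ j) S)
    (hzp : parity (mv (2 ^ j) S z) = 1) (hz' : z' ∈ moves (2 ^ j) S)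
    (hzp' : parity (mv (2 ^ j) S z') = 1) : z = z' := by
  induction hn : (partOfBeta S).sum using Nat.strong_induction_on generalizing S z z' with
  | _ n ih =>
    have hj0 : 0 < 2 ^ j := by positivity
    have hn0 : n ≠ 0 := by omega
    set a := Nat.log 2 n with ha
    have hlo : 2 ^ a ≤ n := Nat.pow_log_le_self 2 hn0
    have hhi : n < 2 * 2 ^ a := by
      rw [← pow_succ']
      exact Nat.lt_pow_succ_log_self one_lt_two n
    have hja : j ≤ a := by
      rw [ha]
      exact Nat.le_log_of_pow_le one_lt_two (by omega)
    rcases hja.eq_or_lt with rfl | hja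
    · exact moves_subsingleton (by omega) hz hz'
    have hlt : 2 ^ j < 2 ^ a := Nat.pow_lt_pow_right one_lt_two hja
    obtain ⟨x, hx, hxp⟩ := exists_move_of_parity hS (j := a) (by omega)
    have hsx := sum_partOfBeta_mv hx
    by_cases hcase : n < 2 ^ a + 2 ^ j
    · have key : ∀ y ∈ moves (2 ^ j) S, y = x ∨ y = x - 2 ^ a + 2 ^ j := by
        intro y hy
        by_contra! hne
        have hsy := sum_partOfBeta_mv hy
        refine not_mem_moves_of_sum_lt (S := mv (2 ^ j) S y) (e := 2 ^ a) (by omega) x ?_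
        simp only [mem_moves, mem_mv] at hx hy ⊢
        grind
      by_contra hne
      have hm : moves (2 ^ j) S = {z, z'} := by
        ext y
        simp only [Finset.mem_insert, Finset.mem_singleton]
        constructor
        · intro hy
          have h1 := key y hy
          have h2 := key z hz
          have h3 := key z' hz'
          omega
        · rintro (rfl | rfl) <;> assumption
      rw [parity_eq_sum_moves j S (by omega), hm, Finset.sum_pair hne, hzp, hzp'] at hS
      exact absurd hS (by decide)
    · have step : ∀ y ∈ moves (2 ^ j) S, parity (mv (2 ^ j) S y) = 1 →
          ∃ w ∈ moves (2 ^ j) (mv (2 ^ a) S x), parity (mv (2 ^ j) (mv (2 ^ a) S x) w) = 1 ∧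
          y = if w = x - 2 ^ a then x else if w = x + 2 ^ j then x - 2 ^ a + 2 ^ j else w := by
        intro y hy hyp
        have hsy := sum_partOfBeta_mv hy
        obtain ⟨u, hu, hup⟩ := exists_move_of_parity hyp (j := a) (by omega)
        obtain ⟨w, hw, hweq, hyw⟩ := exists_commuting_move hj0 hlt hx (by omega) hy hu
        exact ⟨w, hw, by rw [hweq, hup], hyw⟩
      obtain ⟨w, hw, hwp, hzw⟩ := step z hz hzp
      obtain ⟨w', hw', hwp', hzw'⟩ := step z' hz' hzp'
      have hsw := sum_partOfBeta_mv hw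
      have : w = w' := ih _ (by omega) hxp (by omega) hw hwp hw' hwp' rfl
      rw [hzw, hzw', this]

lemma betaSet_succ {lam : Multiset ℕ} {m : ℕ} (h : Multiset.card lam ≤ m) :
    betaSet lam (m + 1) = insert 0 ((betaSet lam m).image Nat.succ) := by
  ext y
  simp only [betaSet, Finset.mem_image, Finset.mem_range, Finset.mem_insert, Nat.succ_eq_add_one,
    exists_exists_and_eq_and]
  have hlen : (descList lam).length = Multiset.card lam := by simp [descList]
  constructor
  · rintro ⟨i, hi, rfl⟩
    rcases Nat.lt_succ_iff_lt_or_eq.1 hi with hi | rfl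
    · exact Or.inr ⟨i, hi, by omega⟩
    · left
      rw [List.getD_eq_default _ _ (by omega)]
      omega
  · rintro (rfl | ⟨i, hi, rfl⟩)
    · exact ⟨m, by omega, by rw [List.getD_eq_default _ _ (by omega)]; omega⟩
    · exact ⟨i, by omega, by omega⟩

lemma mv_insert_image_succ {e : ℕ} {S : Finset ℕ} {x : ℕ} (hx : x ∈ moves e S) :
    x + 1 ∈ moves e (insert 0 (S.image Nat.succ)) ∧
      mv e (insert 0 (S.image Nat.succ)) (x + 1) = insert 0 ((mv e S x).image Nat.succ) := by
  rw [mem_moves] at hx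
  obtain ⟨hxS, hex, hn⟩ := hx
  obtain ⟨y, rfl⟩ := Nat.exists_eq_add_of_le' hex
  have h2 : y + e + 1 - e = y + 1 := by omega
  rw [Nat.add_sub_cancel] at hn
  constructor
  · rw [mem_moves, h2]
    refine ⟨?_, by omega, ?_⟩
    · simpa using hxS
    · simpa using hn
  · ext z
    rw [mem_mv, h2]
    cases z <;> simp [mem_mv]

lemma moves_insert_image_succ (e : ℕ) (S : Finset ℕ) :
    moves e (insert 0 (S.image Nat.succ)) = (moves e S).image Nat.succ := by
  ext z
  rw [Finset.mem_image]
  constructor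
  · intro hz
    rw [mem_moves] at hz
    obtain ⟨hzS, hez, hn⟩ := hz
    obtain ⟨y, rfl⟩ := Nat.exists_eq_add_of_le' hez
    rw [Nat.add_sub_cancel] at hn
    cases y with
    | zero => simp at hn
    | succ y =>
      refine ⟨y + e, ?_, by simp only [Nat.succ_eq_add_one]; omega⟩
      rw [mem_moves, Nat.add_sub_cancel]
      rw [show y + 1 + e = (y + e) + 1 by omega] at hzS
      refine ⟨?_, by omega, ?_⟩
      · simpa using hzS
      · simpa using hn
  · rintro ⟨x, hx, rfl⟩
    exact (mv_insert_image_succ hx).1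

lemma partOfBeta_insert_image_succ (S : Finset ℕ) :
    partOfBeta (insert 0 (S.image Nat.succ)) = partOfBeta S := by
  have h := betaSet_succ (card_partOfBeta_le S)
  rw [betaSet_partOfBeta] at h
  rw [← h, partOfBeta_betaSet (partOfBeta_pos S) ((card_partOfBeta_le S).trans (Nat.le_succ _))]

/-- The partitions obtained from `lam` by removing an `e`-hook. -/
def hookSet (e : ℕ) (lam : Multiset ℕ) : Finset (Multiset ℕ) :=
  (moves e (betaSet lam (Multiset.card lam))).image
    fun x => partOfBeta (mv e (betaSet lam (Multiset.card lam)) x)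

lemma hookSet_eq {e m : ℕ} {lam : Multiset ℕ} (hm : Multiset.card lam ≤ m) :
    hookSet e lam = (moves e (betaSet lam m)).image
      fun x => partOfBeta (mv e (betaSet lam m) x) := by
  induction m, hm using Nat.le_induction with
  | base => rfl
  | succ m hm ih =>
    rw [ih, betaSet_succ hm, moves_insert_image_succ, Finset.image_image]
    refine Finset.image_congr fun x hx => ?_
    simp only [Function.comp_apply, Nat.succ_eq_add_one]
    rw [(mv_insert_image_succ hx).2, partOfBeta_insert_image_succ]

lemma mem_hookSet_iff {e m : ℕ} {lam mu : Multiset ℕ} (hm : Multiset.card lam ≤ m) :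
    mu ∈ hookSet e lam ↔
      ∃ x ∈ moves e (betaSet lam m), partOfBeta (mv e (betaSet lam m) x) = mu := by
  rw [hookSet_eq hm, Finset.mem_image]

lemma isHookRemoval_iff {e : ℕ} {lam mu : Multiset ℕ} (he : 0 < e) (hl : ∀ y ∈ lam, 0 < y) :
    IsHookRemoval e lam mu ↔ mu ∈ hookSet e lam := by
  constructor
  · rintro ⟨-, hmu, -, m, x, hlm, hmm, hx, hex, hn, heq⟩
    rw [mem_hookSet_iff hlm]
    refine ⟨x, mem_moves.2 ⟨hx, hex, hn⟩, ?_⟩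
    rw [mv, ← heq, partOfBeta_betaSet hmu hmm]
  · intro h
    obtain ⟨x, hx, rfl⟩ := (mem_hookSet_iff le_rfl).1 h
    have hc := card_mv hx
    rw [card_betaSet lam _ le_rfl] at hc
    have hxm := mem_moves.1 hx
    refine ⟨hl, partOfBeta_pos _, he, _, x, le_rfl, ?_, hxm.1, hxm.2.1, hxm.2.2, ?_⟩
    · have := card_partOfBeta_le (mv e (betaSet lam (Multiset.card lam)) x)
      rwa [hc] at this
    · have := betaSet_partOfBeta (mv e (betaSet lam (Multiset.card lam)) x)
      rwa [hc] at this

lemma pos_of_mem_hookSet {e : ℕ} {lam mu : Multiset ℕ} (h : mu ∈ hookSet e lam) :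
    ∀ y ∈ mu, 0 < y := by
  obtain ⟨x, -, rfl⟩ := (mem_hookSet_iff le_rfl).1 h
  exact partOfBeta_pos _

lemma sum_of_mem_hookSet {e : ℕ} {lam mu : Multiset ℕ} (hl : ∀ y ∈ lam, 0 < y)
    (h : mu ∈ hookSet e lam) : mu.sum + e = lam.sum := by
  obtain ⟨x, hx, rfl⟩ := (mem_hookSet_iff le_rfl).1 h
  rw [sum_partOfBeta_mv hx, partOfBeta_betaSet hl le_rfl]

lemma partOfBeta_mv_injOn {e : ℕ} (he : 0 < e) (S : Finset ℕ) :
    Set.InjOn (fun x => partOfBeta (mv e S x)) (moves e S) := by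
  intro x hx y hy hxy
  exact mv_injOn he hx (partOfBeta_injective (by rw [card_mv hx, card_mv hy]) hxy)

/-- The parity of the number of standard Young tableaux of shape `lam`. -/
def degParity (lam : Multiset ℕ) : ZMod 2 := (degSYT lam : ZMod 2)

lemma oddP_iff {lam : Multiset ℕ} : OddP lam ↔ (∀ x ∈ lam, 0 < x) ∧ degParity lam = 1 := by
  rw [OddP, degParity, ZMod.natCast_eq_one_iff_odd]

lemma degParity_eq_sum_hookSet (j : ℕ) {lam : Multiset ℕ} (hl : ∀ y ∈ lam, 0 < y)
    (h : 2 ^ j ≤ lam.sum) : degParity lam = ∑ mu ∈ hookSet (2 ^ j) lam, degParity mu := by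
  have hp := partOfBeta_betaSet hl le_rfl
  rw [hookSet, Finset.sum_image (partOfBeta_mv_injOn (by positivity) _)]
  have := parity_eq_sum_moves j (betaSet lam (Multiset.card lam)) (by rwa [hp])
  rwa [parity, hp] at this

lemma exists_unique_odd_hook {j : ℕ} {lam : Multiset ℕ} (hl : OddP lam) (h : 2 ^ j ≤ lam.sum) :
    ∃ mu, IsHookRemoval (2 ^ j) lam mu ∧ OddP mu ∧
      ∀ nu, IsHookRemoval (2 ^ j) lam nu → OddP nu → nu = mu := by
  have h0 : 0 < 2 ^ j := by positivity
  rw [oddP_iff] at hl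
  have hp := partOfBeta_betaSet hl.1 le_rfl
  have hS : parity (betaSet lam (Multiset.card lam)) = 1 := by rw [parity, hp]; exact hl.2
  obtain ⟨x, hx, hxp⟩ := exists_move_of_parity hS (j := j) (by rwa [hp])
  refine ⟨_, (isHookRemoval_iff h0 hl.1).2 ((mem_hookSet_iff le_rfl).2 ⟨x, hx, rfl⟩),
    oddP_iff.2 ⟨partOfBeta_pos _, hxp⟩, fun nu hnu hodd => ?_⟩
  obtain ⟨y, hy, rfl⟩ := (mem_hookSet_iff le_rfl).1 ((isHookRemoval_iff h0 hl.1).1 hnu)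
  rw [move_unique_of_parity hS (j := j) (by rwa [hp]) hx hxp hy (oddP_iff.1 hodd).2]

lemma fkOp_spec {j : ℕ} {lam : Multiset ℕ} (hl : OddP lam) (h : 2 ^ j ≤ lam.sum) :
    IsHookRemoval (2 ^ j) lam (fkOp j lam) ∧ OddP (fkOp j lam) := by
  obtain ⟨mu, h1, h2, -⟩ := exists_unique_odd_hook hl h
  have hex : ∃ mu, IsHookRemoval (2 ^ j) lam mu ∧ OddP mu := ⟨mu, h1, h2⟩
  rw [fkOp, dif_pos hex]
  exact hex.choose_spec

lemma eq_fkOp {j : ℕ} {lam mu : Multiset ℕ} (hl : OddP lam) (h : 2 ^ j ≤ lam.sum)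
    (hmu : IsHookRemoval (2 ^ j) lam mu) (hodd : OddP mu) : mu = fkOp j lam := by
  obtain ⟨nu, -, -, h3⟩ := exists_unique_odd_hook hl h
  rw [h3 mu hmu hodd, h3 _ (fkOp_spec hl h).1 (fkOp_spec hl h).2]

/-- All parts of `lam` are positive. -/
abbrev IsPart (lam : Multiset ℕ) : Prop := ∀ x ∈ lam, 0 < x

lemma hookSet_partOfBeta (e : ℕ) (S : Finset ℕ) :
    hookSet e (partOfBeta S) = (moves e S).image fun x => partOfBeta (mv e S x) := by
  rw [hookSet_eq (card_partOfBeta_le S), betaSet_partOfBeta]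

/-- The even runner of the 2-abacus. -/
def evenRunner (S : Finset ℕ) : Finset ℕ := (S.filter (fun b => b % 2 = 0)).image (fun b => b / 2)

/-- The odd runner of the 2-abacus. -/
def oddRunner (S : Finset ℕ) : Finset ℕ := (S.filter (fun b => b % 2 = 1)).image (fun b => b / 2)

lemma mem_evenRunner {S : Finset ℕ} {y : ℕ} : y ∈ evenRunner S ↔ 2 * y ∈ S := by
  simp only [evenRunner, Finset.mem_image, Finset.mem_filter]
  constructor
  · rintro ⟨b, ⟨hb, hb2⟩, rfl⟩
    rwa [show 2 * (b / 2) = b by omega]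
  · exact fun h => ⟨2 * y, ⟨h, by omega⟩, by omega⟩

lemma mem_oddRunner {S : Finset ℕ} {y : ℕ} : y ∈ oddRunner S ↔ 2 * y + 1 ∈ S := by
  simp only [oddRunner, Finset.mem_image, Finset.mem_filter]
  constructor
  · rintro ⟨b, ⟨hb, hb2⟩, rfl⟩
    rwa [show 2 * (b / 2) + 1 = b by omega]
  · exact fun h => ⟨2 * y + 1, ⟨h, by omega⟩, by omega⟩

/-- The beta-set with given even and odd runners. -/
def mergeRunners (A B : Finset ℕ) : Finset ℕ :=
  A.image (fun a => 2 * a) ∪ B.image (fun b => 2 * b + 1)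

lemma evenRunner_mergeRunners (A B : Finset ℕ) : evenRunner (mergeRunners A B) = A := by
  ext y
  simp only [mem_evenRunner, mergeRunners, Finset.mem_union, Finset.mem_image]
  constructor
  · rintro (⟨a, ha, h⟩ | ⟨b, hb, h⟩)
    · rwa [show y = a by omega]
    · omega
  · exact fun h => Or.inl ⟨y, h, rfl⟩

lemma oddRunner_mergeRunners (A B : Finset ℕ) : oddRunner (mergeRunners A B) = B := by
  ext y
  simp only [mem_oddRunner, mergeRunners, Finset.mem_union, Finset.mem_image]
  constructor
  · rintro (⟨a, ha, h⟩ | ⟨b, hb, h⟩)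
    · omega
    · rwa [show y = b by omega]
  · exact fun h => Or.inr ⟨y, h, rfl⟩

lemma mergeRunners_runners (S : Finset ℕ) : mergeRunners (evenRunner S) (oddRunner S) = S := by
  ext y
  simp only [mergeRunners, Finset.mem_union, Finset.mem_image, mem_evenRunner, mem_oddRunner]
  constructor
  · rintro (⟨a, ha, rfl⟩ | ⟨b, hb, rfl⟩) <;> assumption
  · intro h
    rcases Nat.even_or_odd' y with ⟨a, rfl | rfl⟩
    · exact Or.inl ⟨a, h, rfl⟩
    · exact Or.inr ⟨a, h, rfl⟩

lemma disjoint_images (A B : Finset ℕ) :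
    Disjoint (A.image (fun a => 2 * a)) (B.image (fun b => 2 * b + 1)) := by
  rw [Finset.disjoint_left]
  intro x hx hy
  simp only [Finset.mem_image] at hx hy
  obtain ⟨a, -, rfl⟩ := hx
  obtain ⟨b, -, h⟩ := hy
  omega

lemma sum_mergeRunners (f : ℕ → ℕ) (A B : Finset ℕ) :
    ∑ x ∈ mergeRunners A B, f x = ∑ a ∈ A, f (2 * a) + ∑ b ∈ B, f (2 * b + 1) := by
  rw [mergeRunners, Finset.sum_union (disjoint_images A B),
    Finset.sum_image (fun a _ b _ h => by simpa using h),
    Finset.sum_image (fun a _ b _ h => by simpa using h)]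

lemma card_mergeRunners (A B : Finset ℕ) : (mergeRunners A B).card = A.card + B.card := by
  have := sum_mergeRunners (fun _ => 1) A B
  simpa using this

lemma card_runners (S : Finset ℕ) : (evenRunner S).card + (oddRunner S).card = S.card := by
  rw [← card_mergeRunners, mergeRunners_runners]

/-- The number labelling the 2-core of `lam`: the excess of beads on the even runner. -/
def coreInt (lam : Multiset ℕ) : ℤ :=
  (evenRunner (betaSet lam (2 * Multiset.card lam))).card - (Multiset.card lam : ℤ)

lemma runners_insert_image_succ (S : Finset ℕ) :
    evenRunner (insert 0 ((insert 0 (S.image Nat.succ)).image Nat.succ)) =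
      insert 0 ((evenRunner S).image Nat.succ) ∧
    oddRunner (insert 0 ((insert 0 (S.image Nat.succ)).image Nat.succ)) =
      insert 0 ((oddRunner S).image Nat.succ) := by
  constructor
  · ext y
    rw [mem_evenRunner]
    cases y <;> simp [mem_evenRunner, Nat.mul_add]
  · ext y
    rw [mem_oddRunner]
    cases y <;> simp [mem_oddRunner, Nat.mul_add]

lemma runners_betaSet_of_le {lam : Multiset ℕ} {m m' : ℕ} (hm : Multiset.card lam ≤ 2 * m)
    (h : m ≤ m') :
    partOfBeta (evenRunner (betaSet lam (2 * m'))) = partOfBeta (evenRunner (betaSet lam (2 * m)))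
      ∧ partOfBeta (oddRunner (betaSet lam (2 * m'))) =
        partOfBeta (oddRunner (betaSet lam (2 * m)))
      ∧ (evenRunner (betaSet lam (2 * m'))).card + m =
        (evenRunner (betaSet lam (2 * m))).card + m' := by
  induction m', h using Nat.le_induction with
  | base => simp
  | succ m' h ih =>
    have hb : betaSet lam (2 * (m' + 1)) =
        insert 0 ((insert 0 ((betaSet lam (2 * m')).image Nat.succ)).image Nat.succ) := by
      rw [Nat.mul_add, show 2 * m' + 2 * 1 = 2 * m' + 1 + 1 by rfl, betaSet_succ (by omega),
        betaSet_succ (by omega)]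
    obtain ⟨h1, h2⟩ := runners_insert_image_succ (betaSet lam (2 * m'))
    rw [hb, h1, h2, partOfBeta_insert_image_succ, partOfBeta_insert_image_succ]
    refine ⟨ih.1, ih.2.1, ?_⟩
    rw [Finset.card_insert_of_notMem (by simp), Finset.card_image_of_injective _
      Nat.succ_injective]
    omega

lemma quot2_eq_and_coreInt_eq {lam : Multiset ℕ} {m : ℕ} (hm : Multiset.card lam ≤ 2 * m) :
    quot2 lam = (partOfBeta (evenRunner (betaSet lam (2 * m))),
      partOfBeta (oddRunner (betaSet lam (2 * m)))) ∧
    coreInt lam = (evenRunner (betaSet lam (2 * m))).card - (m : ℤ) := by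
  have hq : quot2 lam = (partOfBeta (evenRunner (betaSet lam (2 * Multiset.card lam))),
      partOfBeta (oddRunner (betaSet lam (2 * Multiset.card lam)))) := rfl
  rw [hq, coreInt]
  rcases le_total m (Multiset.card lam) with h | h
  · obtain ⟨h1, h2, h3⟩ := runners_betaSet_of_le hm h
    exact ⟨by rw [h1, h2], by omega⟩
  · obtain ⟨h1, h2, h3⟩ := runners_betaSet_of_le (lam := lam) (by omega) h
    exact ⟨by rw [h1, h2], by omega⟩

lemma quot2_partOfBeta {S : Finset ℕ} {m : ℕ} (hS : S.card = 2 * m) :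
    quot2 (partOfBeta S) = (partOfBeta (evenRunner S), partOfBeta (oddRunner S)) := by
  rw [(quot2_eq_and_coreInt_eq (hS ▸ card_partOfBeta_le S)).1, ← hS, betaSet_partOfBeta]

lemma coreInt_partOfBeta {S : Finset ℕ} {m : ℕ} (hS : S.card = 2 * m) :
    coreInt (partOfBeta S) = (evenRunner S).card - (m : ℤ) := by
  rw [(quot2_eq_and_coreInt_eq (hS ▸ card_partOfBeta_le S)).2, ← hS, betaSet_partOfBeta]

lemma exists_partOfBeta_eq {lam : Multiset ℕ} (h : IsPart lam) {m : ℕ}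
    (hm : Multiset.card lam ≤ m) : ∃ S : Finset ℕ, S.card = 2 * m ∧ partOfBeta S = lam :=
  ⟨betaSet lam (2 * m), card_betaSet _ _ (by omega), partOfBeta_betaSet h (by omega)⟩

lemma quot2_isPart (lam : Multiset ℕ) : IsPart (quot2 lam).1 ∧ IsPart (quot2 lam).2 := by
  dsimp only [quot2]
  exact ⟨partOfBeta_pos _, partOfBeta_pos _⟩

/-- A partition is determined by its 2-core and its 2-quotient. -/
lemma eq_of_quot2_eq {lam mu : Multiset ℕ} (hl : IsPart lam) (hm : IsPart mu)
    (hq : quot2 lam = quot2 mu) (hc : coreInt lam = coreInt mu) : lam = mu := by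
  obtain ⟨S, hS, hSl⟩ := exists_partOfBeta_eq hl (le_max_left _ (Multiset.card mu))
  obtain ⟨T, hT, hTm⟩ := exists_partOfBeta_eq hm (le_max_right (Multiset.card lam) _)
  rw [← hSl, ← hTm, quot2_partOfBeta hS, quot2_partOfBeta hT, Prod.mk.injEq] at hq
  rw [← hSl, ← hTm, coreInt_partOfBeta hS, coreInt_partOfBeta hT] at hc
  have hS' := card_runners S
  have hT' := card_runners T
  have h0 := partOfBeta_injective (by omega) hq.1
  have h1 := partOfBeta_injective (by omega) hq.2
  rw [← hSl, ← hTm, ← mergeRunners_runners S, ← mergeRunners_runners T, h0, h1]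

/-- Every pair of partitions is the 2-quotient of a partition with given 2-core. -/
lemma exists_quot2_eq (c : ℤ) {l0 l1 : Multiset ℕ} (h0 : IsPart l0) (h1 : IsPart l1) :
    ∃ lam, IsPart lam ∧ quot2 lam = (l0, l1) ∧ coreInt lam = c := by
  obtain ⟨a, b, m, ha, hb, hab, hc⟩ : ∃ a b m : ℕ, Multiset.card l0 ≤ a ∧ Multiset.card l1 ≤ b ∧
      a + b = 2 * m ∧ (a : ℤ) - m = c := by
    refine ⟨(Multiset.card l0 + Multiset.card l1 + c.natAbs + c).toNat,
      (Multiset.card l0 + Multiset.card l1 + c.natAbs - c).toNat,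
      Multiset.card l0 + Multiset.card l1 + c.natAbs, ?_⟩
    omega
  have hcard : (mergeRunners (betaSet l0 a) (betaSet l1 b)).card = 2 * m := by
    rw [card_mergeRunners, card_betaSet _ _ ha, card_betaSet _ _ hb, hab]
  refine ⟨partOfBeta (mergeRunners (betaSet l0 a) (betaSet l1 b)), partOfBeta_pos _, ?_, ?_⟩
  · rw [quot2_partOfBeta hcard, evenRunner_mergeRunners, oddRunner_mergeRunners,
      partOfBeta_betaSet h0 ha, partOfBeta_betaSet h1 hb]
  · rw [coreInt_partOfBeta hcard, evenRunner_mergeRunners, card_betaSet _ _ ha, hc]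

lemma moves_even {e y : ℕ} {S : Finset ℕ} :
    2 * y ∈ moves (2 * e) S ↔ y ∈ moves e (evenRunner S) := by
  rw [mem_moves, mem_moves, mem_evenRunner, mem_evenRunner, Nat.mul_sub]
  simp

lemma moves_odd {e y : ℕ} {S : Finset ℕ} :
    2 * y + 1 ∈ moves (2 * e) S ↔ y ∈ moves e (oddRunner S) := by
  rw [mem_moves, mem_moves, mem_oddRunner, mem_oddRunner, Nat.mul_sub]
  constructor
  · rintro ⟨h1, h2, h3⟩
    exact ⟨h1, by omega, by rwa [show 2 * y - 2 * e + 1 = 2 * y + 1 - 2 * e by omega]⟩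
  · rintro ⟨h1, h2, h3⟩
    exact ⟨h1, by omega, by rwa [show 2 * y + 1 - 2 * e = 2 * y - 2 * e + 1 by omega]⟩

lemma runners_mv_even {e y : ℕ} {S : Finset ℕ} (h : 2 * y ∈ moves (2 * e) S) :
    evenRunner (mv (2 * e) S (2 * y)) = mv e (evenRunner S) y ∧
      oddRunner (mv (2 * e) S (2 * y)) = oddRunner S := by
  have h2 := (mem_moves.1 h).2.1
  constructor
  · ext z
    rw [mem_evenRunner, mem_mv, mem_mv, mem_evenRunner]
    grind
  · ext z
    rw [mem_oddRunner, mem_mv, mem_oddRunner]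
    grind

lemma runners_mv_odd {e y : ℕ} {S : Finset ℕ} (h : 2 * y + 1 ∈ moves (2 * e) S) :
    evenRunner (mv (2 * e) S (2 * y + 1)) = evenRunner S ∧
      oddRunner (mv (2 * e) S (2 * y + 1)) = mv e (oddRunner S) y := by
  have h2 := (mem_moves.1 h).2.1
  constructor
  · ext z
    rw [mem_evenRunner, mem_mv, mem_evenRunner]
    grind
  · ext z
    rw [mem_oddRunner, mem_mv, mem_mv, mem_oddRunner]
    grind

/-- Removing a `2e`-hook amounts to removing an `e`-hook from one 2-quotient component. -/
lemma isHookRemoval_two_mul {e : ℕ} {lam mu : Multiset ℕ} (he : 0 < e) (hl : IsPart lam)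
    (hm : IsPart mu) : IsHookRemoval (2 * e) lam mu ↔ coreInt lam = coreInt mu ∧
      ((IsHookRemoval e (quot2 lam).1 (quot2 mu).1 ∧ (quot2 lam).2 = (quot2 mu).2) ∨
        ((quot2 lam).1 = (quot2 mu).1 ∧ IsHookRemoval e (quot2 lam).2 (quot2 mu).2)) := by
  rw [isHookRemoval_iff (by omega) hl, isHookRemoval_iff he (quot2_isPart lam).1,
    isHookRemoval_iff he (quot2_isPart lam).2]
  obtain ⟨S, hS, rfl⟩ := exists_partOfBeta_eq hl le_rfl
  have key0 : ∀ y ∈ moves e (evenRunner S),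
      2 * y ∈ moves (2 * e) S ∧
      quot2 (partOfBeta (mv (2 * e) S (2 * y))) =
        (partOfBeta (mv e (evenRunner S) y), partOfBeta (oddRunner S)) ∧
      coreInt (partOfBeta (mv (2 * e) S (2 * y))) = coreInt (partOfBeta S) := by
    intro y hy
    have hy2 := moves_even.2 hy
    have hc : (mv (2 * e) S (2 * y)).card = _ := (card_mv hy2).trans hS
    refine ⟨hy2, ?_, ?_⟩
    · rw [quot2_partOfBeta hc, (runners_mv_even hy2).1, (runners_mv_even hy2).2]
    · rw [coreInt_partOfBeta hc, (runners_mv_even hy2).1, card_mv hy, coreInt_partOfBeta hS]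
  have key1 : ∀ y ∈ moves e (oddRunner S),
      2 * y + 1 ∈ moves (2 * e) S ∧
      quot2 (partOfBeta (mv (2 * e) S (2 * y + 1))) =
        (partOfBeta (evenRunner S), partOfBeta (mv e (oddRunner S) y)) ∧
      coreInt (partOfBeta (mv (2 * e) S (2 * y + 1))) = coreInt (partOfBeta S) := by
    intro y hy
    have hy2 := moves_odd.2 hy
    have hc : (mv (2 * e) S (2 * y + 1)).card = _ := (card_mv hy2).trans hS
    refine ⟨hy2, ?_, ?_⟩
    · rw [quot2_partOfBeta hc, (runners_mv_odd hy2).1, (runners_mv_odd hy2).2]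
    · rw [coreInt_partOfBeta hc, (runners_mv_odd hy2).1, coreInt_partOfBeta hS]
  have hqS := quot2_partOfBeta hS
  have hL : (quot2 (partOfBeta S)).1 = partOfBeta (evenRunner S) := by rw [hqS]
  have hR : (quot2 (partOfBeta S)).2 = partOfBeta (oddRunner S) := by rw [hqS]
  rw [hL, hR]
  simp only [hookSet_partOfBeta, Finset.mem_image]
  constructor
  · rintro ⟨x, hx, rfl⟩
    rcases Nat.even_or_odd' x with ⟨y, rfl | rfl⟩
    · have hy := moves_even.1 hx
      obtain ⟨h1, h2, h3⟩ := key0 y hy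
      rw [h2]
      exact ⟨h3.symm, Or.inl ⟨⟨y, hy, rfl⟩, rfl⟩⟩
    · have hy := moves_odd.1 hx
      obtain ⟨h1, h2, h3⟩ := key1 y hy
      rw [h2]
      exact ⟨h3.symm, Or.inr ⟨rfl, ⟨y, hy, rfl⟩⟩⟩
  · rintro ⟨hc, ⟨⟨y, hy, h1⟩, h2⟩ | ⟨h1, y, hy, h2⟩⟩
    · obtain ⟨h3, h4, h5⟩ := key0 y hy
      refine ⟨_, h3, eq_of_quot2_eq (partOfBeta_pos _) hm ?_ (h5.trans hc)⟩
      rw [h4, h1, h2]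
    · obtain ⟨h3, h4, h5⟩ := key1 y hy
      refine ⟨_, h3, eq_of_quot2_eq (partOfBeta_pos _) hm ?_ (h5.trans hc)⟩
      rw [h4, h1, h2]

/-- The size of the 2-core with label `c`. -/
def coreSize (c : ℤ) : ℤ := c * (2 * c - 1)

lemma coreSize_nonneg (c : ℤ) : 0 ≤ coreSize c := by
  unfold coreSize
  rcases le_or_gt c 0 with h | h <;> nlinarith

lemma coreSize_eq_zero {c : ℤ} (h : coreSize c = 0) : c = 0 := by
  rcases mul_eq_zero.1 h with h | h <;> omega

lemma sum_eq_quot2 {lam : Multiset ℕ} (hl : IsPart lam) :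
    (lam.sum : ℤ) = 2 * ((quot2 lam).1.sum + (quot2 lam).2.sum) + coreSize (coreInt lam) := by
  obtain ⟨S, hS, rfl⟩ := exists_partOfBeta_eq hl le_rfl
  generalize Multiset.card (partOfBeta S) = m at hS
  rw [quot2_partOfBeta hS, coreInt_partOfBeta hS]
  have h1 := sum_partOfBeta S
  have h2 := sum_partOfBeta (evenRunner S)
  have h3 := sum_partOfBeta (oddRunner S)
  have h4 := sum_mergeRunners (fun x => x) (evenRunner S) (oddRunner S)
  have h5 := card_runners S
  have gauss : ∀ n : ℕ, (2 * ((∑ i ∈ Finset.range n, i : ℕ) : ℤ)) = n * (n - 1) := by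
    intro n
    induction n with
    | zero => simp
    | succ n ih => rw [Finset.sum_range_succ]; push_cast at ih ⊢; linarith
  have g1 := gauss S.card
  have g2 := gauss (evenRunner S).card
  have g3 := gauss (oddRunner S).card
  rw [mergeRunners_runners, Finset.sum_add_distrib, ← Finset.mul_sum, ← Finset.mul_sum] at h4
  simp only [Finset.sum_const, smul_eq_mul, mul_one] at h4
  generalize ∑ i ∈ Finset.range S.card, i = s1 at *
  generalize ∑ i ∈ Finset.range (evenRunner S).card, i = s2 at *
  generalize ∑ i ∈ Finset.range (oddRunner S).card, i = s3 at *
  generalize (evenRunner S).card = p at *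
  generalize (oddRunner S).card = r at *
  have hr : (r : ℤ) = 2 * m - p := by omega
  have hs : (S.card : ℤ) = 2 * m := by omega
  rw [hr] at g3
  rw [hs] at g1
  generalize (partOfBeta S).sum = u1 at *
  generalize (partOfBeta (evenRunner S)).sum = u2 at *
  generalize (partOfBeta (oddRunner S)).sum = u3 at *
  zify at h1 h2 h3 h4
  rw [hr] at h4
  unfold coreSize
  linarith

lemma partOfBeta_empty : partOfBeta ∅ = 0 := rfl

lemma quot2_zero : quot2 0 = (0, 0) := by
  have := quot2_partOfBeta (S := ∅) (m := 0) rfl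
  rwa [show evenRunner ∅ = ∅ from rfl, show oddRunner ∅ = ∅ from rfl, partOfBeta_empty] at this

lemma coreInt_zero : coreInt 0 = 0 := by
  have := coreInt_partOfBeta (S := ∅) (m := 0) rfl
  rwa [show evenRunner ∅ = ∅ from rfl, partOfBeta_empty] at this

/-- Replace each entry of a row by its 2-quotient pair. -/
def quotRow (L : List (Multiset ℕ)) : List (Multiset ℕ) :=
  L.flatMap (fun mu => [(quot2 mu).1, (quot2 mu).2])

lemma quotRow_cons (a : Multiset ℕ) (L : List (Multiset ℕ)) :
    quotRow (a :: L) = (quot2 a).1 :: (quot2 a).2 :: quotRow L := rfl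

lemma towerRow_succ (k : ℕ) (lam : Multiset ℕ) :
    towerRow (k + 1) lam = quotRow (towerRow k lam) := rfl

lemma length_quotRow (L : List (Multiset ℕ)) : (quotRow L).length = 2 * L.length := by
  induction L with
  | nil => rfl
  | cons a L ih => simp only [quotRow_cons, List.length_cons, ih]; omega

lemma length_towerRow (k : ℕ) (lam : Multiset ℕ) : (towerRow k lam).length = 2 ^ k := by
  induction k with
  | zero => rfl
  | succ k ih => rw [towerRow_succ, length_quotRow, ih, pow_succ']

/-- All entries of the row are partitions. -/
abbrev IsPartRow (L : List (Multiset ℕ)) : Prop := ∀ a ∈ L, IsPart a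

lemma isPartRow_quotRow (L : List (Multiset ℕ)) : IsPartRow (quotRow L) := by
  intro a ha
  simp only [quotRow, List.mem_flatMap, List.mem_cons, List.not_mem_nil, or_false] at ha
  obtain ⟨b, -, rfl | rfl⟩ := ha
  · exact (quot2_isPart b).1
  · exact (quot2_isPart b).2

lemma isPartRow_towerRow {lam : Multiset ℕ} (hl : IsPart lam) (k : ℕ) :
    IsPartRow (towerRow k lam) := by
  cases k with
  | zero =>
    intro a ha
    rw [towerRow, List.mem_singleton] at ha
    exact ha ▸ hl
  | succ k => exact isPartRow_quotRow _

/-- `L'` arises from `L` by removing an `e`-hook from exactly one entry. -/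
inductive RowHook (e : ℕ) : List (Multiset ℕ) → List (Multiset ℕ) → Prop
  | head {a b : Multiset ℕ} (L : List (Multiset ℕ)) (h : IsHookRemoval e a b) :
      RowHook e (a :: L) (b :: L)
  | tail (a : Multiset ℕ) {L L' : List (Multiset ℕ)} (h : RowHook e L L') :
      RowHook e (a :: L) (a :: L')

lemma rowHook_cons_iff {e : ℕ} {a b : Multiset ℕ} {L L' : List (Multiset ℕ)} :
    RowHook e (a :: L) (b :: L') ↔ (IsHookRemoval e a b ∧ L = L') ∨ (a = b ∧ RowHook e L L') := by
  constructor
  · intro h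
    cases h with
    | head _ h => exact Or.inl ⟨h, rfl⟩
    | tail _ h => exact Or.inr ⟨rfl, h⟩
  · rintro (⟨h, rfl⟩ | ⟨rfl, h⟩)
    · exact .head _ h
    · exact .tail _ h

lemma not_rowHook_nil {e : ℕ} {L : List (Multiset ℕ)} : ¬ RowHook e [] L := by
  intro h
  cases h

lemma RowHook.length_eq {e : ℕ} {L L' : List (Multiset ℕ)} (h : RowHook e L L') :
    L.length = L'.length := by
  induction h with
  | head => rfl
  | tail _ _ ih => simp [ih]

lemma eq_of_quotRow_eq {L L' : List (Multiset ℕ)} (hL : IsPartRow L) (hL' : IsPartRow L')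
    (hc : L.map coreInt = L'.map coreInt) (hq : quotRow L = quotRow L') : L = L' := by
  induction L generalizing L' with
  | nil => simpa using hc
  | cons a L ih =>
    cases L' with
    | nil => simp at hc
    | cons b L' =>
      simp only [List.forall_mem_cons] at hL hL'
      simp only [List.map_cons, List.cons.injEq, quotRow_cons] at hc hq
      rw [ih hL.2 hL'.2 hc.2 hq.2.2,
        eq_of_quot2_eq hL.1 hL'.1 (Prod.ext hq.1 hq.2.1) hc.1]

lemma exists_quotRow_eq (cs : List ℤ) {R : List (Multiset ℕ)} (hR : IsPartRow R)
    (hlen : R.length = 2 * cs.length) :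
    ∃ L, IsPartRow L ∧ L.map coreInt = cs ∧ quotRow L = R := by
  induction cs generalizing R with
  | nil => exact ⟨[], fun _ h => absurd h List.not_mem_nil, rfl,
      (List.length_eq_zero_iff.1 hlen).symm⟩
  | cons c cs ih =>
    match R, hR, hlen with
    | [], _, h => simp at h
    | [_], _, h => simp at h; omega
    | a :: b :: R, hR, h =>
      simp only [List.forall_mem_cons] at hR
      obtain ⟨L, hL, hc, hq⟩ := ih hR.2.2 (by simp only [List.length_cons] at h; omega)
      obtain ⟨lam, hl, hql, hcl⟩ := exists_quot2_eq c hR.1 hR.2.1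
      exact ⟨lam :: L, by simp only [List.forall_mem_cons]; exact ⟨hl, hL⟩, by simp [hc, hcl],
        by simp [quotRow_cons, hql, hq]⟩

lemma rowHook_two_mul {e : ℕ} {L L' : List (Multiset ℕ)} (he : 0 < e) (hL : IsPartRow L)
    (hL' : IsPartRow L') : RowHook (2 * e) L L' ↔
      L.map coreInt = L'.map coreInt ∧ RowHook e (quotRow L) (quotRow L') := by
  induction L generalizing L' with
  | nil => exact iff_of_false not_rowHook_nil fun h => not_rowHook_nil h.2
  | cons a L ih =>
    cases L' with
    | nil =>
      refine iff_of_false (fun h => ?_) (fun h => ?_)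
      · simpa using h.length_eq
      · simpa using h.1
    | cons b L' =>
      simp only [List.forall_mem_cons] at hL hL'
      simp only [List.map_cons, List.cons.injEq, quotRow_cons, rowHook_cons_iff,
        ih hL.2 hL'.2, isHookRemoval_two_mul he hL.1 hL'.1]
      constructor
      · rintro (⟨⟨hc, ⟨h1, h2⟩ | ⟨h1, h2⟩⟩, rfl⟩ | ⟨rfl, hc, h⟩)
        · exact ⟨⟨hc, rfl⟩, Or.inl ⟨h1, h2, rfl⟩⟩
        · exact ⟨⟨hc, rfl⟩, Or.inr ⟨h1, Or.inl ⟨h2, rfl⟩⟩⟩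
        · exact ⟨⟨rfl, hc⟩, Or.inr ⟨rfl, Or.inr ⟨rfl, h⟩⟩⟩
      · rintro ⟨⟨hc, hcs⟩, ⟨h1, h2, h3⟩ | ⟨h1, ⟨h2, h3⟩ | ⟨h2, h3⟩⟩⟩
        · exact Or.inl ⟨⟨hc, Or.inl ⟨h1, h2⟩⟩, eq_of_quotRow_eq hL.2 hL'.2 hcs h3⟩
        · exact Or.inl ⟨⟨hc, Or.inr ⟨h1, h2⟩⟩, eq_of_quotRow_eq hL.2 hL'.2 hcs h3⟩
        · exact Or.inr ⟨eq_of_quot2_eq hL.1 hL'.1 (Prod.ext h1 h2) hc, hcs, h3⟩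

/-- The total size of a row. -/
def rowSize (L : List (Multiset ℕ)) : ℕ := (L.map Multiset.sum).sum

/-- The total size of the 2-cores with given labels. -/
def coreRowSize (cs : List ℤ) : ℤ := (cs.map coreSize).sum

lemma rowSize_eq {L : List (Multiset ℕ)} (hL : IsPartRow L) :
    (rowSize L : ℤ) = 2 * rowSize (quotRow L) + coreRowSize (L.map coreInt) := by
  induction L with
  | nil => rfl
  | cons a L ih =>
    simp only [List.forall_mem_cons] at hL
    have h1 := ih hL.2
    have h2 := sum_eq_quot2 hL.1
    simp only [rowSize, coreRowSize, quotRow_cons, List.map_cons, List.sum_cons] at h1 h2 ⊢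
    rw [Nat.cast_add, Nat.cast_add, Nat.cast_add]
    linarith

lemma coreRowSize_nonneg (cs : List ℤ) : 0 ≤ coreRowSize cs := by
  refine List.sum_nonneg fun x hx => ?_
  obtain ⟨c, -, rfl⟩ := List.mem_map.1 hx
  exact coreSize_nonneg c

lemma eq_replicate_of_coreRowSize_eq_zero {cs : List ℤ} (h : coreRowSize cs = 0) :
    cs = List.replicate cs.length 0 := by
  induction cs with
  | nil => rfl
  | cons c cs ih =>
    have h1 := coreRowSize_nonneg cs
    have h2 := coreSize_nonneg c
    simp only [coreRowSize, List.map_cons, List.sum_cons] at h h1 ih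
    rw [List.length_cons, List.replicate_succ, ← ih (by omega),
      coreSize_eq_zero (c := c) (by omega)]

/-- `lam` and `mu` have the same rows `0, …, k - 1` in their 2-core towers. -/
def SameCores (k : ℕ) (lam mu : Multiset ℕ) : Prop :=
  ∀ i < k, (towerRow i lam).map coreInt = (towerRow i mu).map coreInt

lemma SameCores.symm {k : ℕ} {lam mu : Multiset ℕ} (h : SameCores k lam mu) :
    SameCores k mu lam := fun i hi => (h i hi).symm

lemma SameCores.trans {k : ℕ} {lam mu nu : Multiset ℕ} (h : SameCores k lam mu)
    (h' : SameCores k mu nu) : SameCores k lam nu := fun i hi => (h i hi).trans (h' i hi)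

lemma sameCores_succ {k : ℕ} {lam mu : Multiset ℕ} : SameCores (k + 1) lam mu ↔
    SameCores k lam mu ∧ (towerRow k lam).map coreInt = (towerRow k mu).map coreInt := by
  constructor
  · exact fun h => ⟨fun i hi => h i (by omega), h k (by omega)⟩
  · rintro ⟨h, h'⟩ i hi
    rcases Nat.lt_succ_iff_lt_or_eq.1 hi with hi | rfl
    · exact h i hi
    · exact h'

lemma eq_of_towerRow_eq {k : ℕ} {lam mu : Multiset ℕ} (hl : IsPart lam) (hm : IsPart mu)
    (hc : SameCores k lam mu) (hr : towerRow k lam = towerRow k mu) : lam = mu := by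
  induction k with
  | zero => simpa [towerRow] using hr
  | succ k ih =>
    rw [sameCores_succ] at hc
    exact ih hc.1 (eq_of_quotRow_eq (isPartRow_towerRow hl k) (isPartRow_towerRow hm k) hc.2 hr)

lemma exists_towerRow_eq (k : ℕ) (al : Multiset ℕ) {R : List (Multiset ℕ)} (hR : IsPartRow R)
    (hlen : R.length = 2 ^ k) :
    ∃ lam, IsPart lam ∧ SameCores k lam al ∧ towerRow k lam = R := by
  induction k generalizing R with
  | zero =>
    obtain ⟨a, rfl⟩ := List.length_eq_one_iff.1 hlen
    exact ⟨a, hR a (by simp), fun i hi => absurd hi (by omega), rfl⟩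
  | succ k ih =>
    obtain ⟨L, hL, hc, hq⟩ := exists_quotRow_eq ((towerRow k al).map coreInt) hR
      (by rw [List.length_map, length_towerRow, hlen, pow_succ'])
    have hlenL : L.length = 2 ^ k := by
      rw [← List.length_map (f := coreInt), hc, List.length_map, length_towerRow]
    obtain ⟨lam, hl, hcl, hrl⟩ := ih hL hlenL
    exact ⟨lam, hl, sameCores_succ.2 ⟨hcl, by rw [hrl, hc]⟩, by rw [towerRow_succ, hrl, hq]⟩

lemma isHookRemoval_two_pow_mul {k e : ℕ} {lam mu : Multiset ℕ} (he : 0 < e) (hl : IsPart lam)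
    (hm : IsPart mu) : IsHookRemoval (2 ^ k * e) lam mu ↔
      SameCores k lam mu ∧ RowHook e (towerRow k lam) (towerRow k mu) := by
  induction k generalizing e with
  | zero =>
    simp only [towerRow, rowHook_cons_iff, not_rowHook_nil]
    simp [SameCores]
  | succ k ih =>
    rw [pow_succ, mul_assoc, ih (by omega), sameCores_succ, and_assoc,
      rowHook_two_mul he (isPartRow_towerRow hl k) (isPartRow_towerRow hm k)]
    rfl

/-- The total weighted size of the rows `0, …, k - 1` of the 2-core tower. -/
def coreTowerSize (k : ℕ) (lam : Multiset ℕ) : ℤ :=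
  ∑ i ∈ Finset.range k, 2 ^ i * coreRowSize ((towerRow i lam).map coreInt)

lemma SameCores.coreTowerSize_eq {k : ℕ} {lam mu : Multiset ℕ} (h : SameCores k lam mu) :
    coreTowerSize k lam = coreTowerSize k mu :=
  Finset.sum_congr rfl fun i hi => by rw [h i (Finset.mem_range.1 hi)]

lemma sum_eq_coreTowerSize_add {lam : Multiset ℕ} (hl : IsPart lam) (k : ℕ) :
    (lam.sum : ℤ) = coreTowerSize k lam + 2 ^ k * rowSize (towerRow k lam) := by
  induction k with
  | zero => simp [coreTowerSize, towerRow, rowSize]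
  | succ k ih =>
    have := rowSize_eq (isPartRow_towerRow hl k)
    rw [ih, coreTowerSize, coreTowerSize, Finset.sum_range_succ, towerRow_succ, this]
    ring

lemma coreTowerSize_nonneg (k : ℕ) (lam : Multiset ℕ) : 0 ≤ coreTowerSize k lam :=
  Finset.sum_nonneg fun i _ => mul_nonneg (by positivity) (coreRowSize_nonneg _)

lemma quotRow_replicate_zero (n : ℕ) :
    quotRow (List.replicate n 0) = List.replicate (2 * n) 0 := by
  induction n with
  | zero => rfl
  | succ n ih => simp [List.replicate_succ, quotRow_cons, quot2_zero, ih, Nat.mul_add]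

lemma towerRow_zero_right (k : ℕ) : towerRow k 0 = List.replicate (2 ^ k) 0 := by
  induction k with
  | zero => rfl
  | succ k ih => rw [towerRow_succ, ih, quotRow_replicate_zero, pow_succ']

lemma sameCores_zero_iff {k : ℕ} {lam : Multiset ℕ} :
    SameCores k lam 0 ↔ coreTowerSize k lam = 0 := by
  constructor
  · intro h
    rw [h.coreTowerSize_eq, coreTowerSize]
    refine Finset.sum_eq_zero fun i _ => ?_
    rw [towerRow_zero_right, List.map_replicate, coreInt_zero]
    simp [coreRowSize, coreSize]
  · intro h i hi
    have h1 := (Finset.sum_eq_zero_iff_of_nonneg fun i _ =>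
      mul_nonneg (by positivity) (coreRowSize_nonneg _)).1 h i (Finset.mem_range.2 hi)
    have h2 : coreRowSize ((towerRow i lam).map coreInt) = 0 := by
      simpa using h1
    rw [eq_replicate_of_coreRowSize_eq_zero h2, List.length_map, length_towerRow,
      towerRow_zero_right, List.map_replicate, coreInt_zero]

lemma isPart_zero : IsPart 0 := fun _ h => absurd h (Multiset.notMem_zero _)

lemma RowHook.rowSize_add {e : ℕ} {L L' : List (Multiset ℕ)} (h : RowHook e L L') :
    rowSize L' + e = rowSize L := by
  induction h with
  | head L h =>
    have := sum_of_mem_hookSet h.1 ((isHookRemoval_iff h.2.2.1 h.1).1 h)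
    simp only [rowSize, List.map_cons, List.sum_cons]
    omega
  | tail a h ih =>
    simp only [rowSize, List.map_cons, List.sum_cons] at ih ⊢
    omega

lemma rowSize_towerRow_zero (k : ℕ) : rowSize (towerRow k 0) = 0 := by
  simp [towerRow_zero_right, rowSize]

lemma eq_zero_of_sum_eq_zero {lam : Multiset ℕ} (hl : IsPart lam) (h : lam.sum = 0) : lam = 0 := by
  refine Multiset.eq_zero_of_forall_notMem fun x hx => ?_
  have h1 := hl x hx
  have h2 := Multiset.le_sum_of_mem hx
  omega

lemma towerRow_eq_of_rowSize_eq_zero {k : ℕ} {lam : Multiset ℕ} (hl : IsPart lam)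
    (h : rowSize (towerRow k lam) = 0) : towerRow k lam = towerRow k 0 := by
  rw [towerRow_zero_right, List.eq_replicate_iff]
  refine ⟨length_towerRow k lam, fun a ha => ?_⟩
  refine eq_zero_of_sum_eq_zero (isPartRow_towerRow hl k a ha) ?_
  exact List.sum_eq_zero_iff.1 h _ (List.mem_map_of_mem ha)

lemma degParity_zero : degParity 0 = 1 := by
  rw [degParity, degSYT, dif_pos rfl, Nat.cast_one]

/-- Parity of the degree is multiplicative over the splitting of the 2-core tower of `lam` into
its first `k` rows and its remaining rows. -/
lemma degParity_eq_mul {k : ℕ} {lam ka be : Multiset ℕ} (hl : IsPart lam) (hk : IsPart ka)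
    (hb : IsPart be) (hlk : SameCores k lam ka) (hk0 : towerRow k ka = towerRow k 0)
    (hb0 : SameCores k be 0) (hbl : towerRow k be = towerRow k lam) :
    degParity lam = degParity ka * degParity be := by
  induction hw : rowSize (towerRow k lam) using Nat.strong_induction_on generalizing lam be with
  | _ w ih =>
    have hsl := sum_eq_coreTowerSize_add hl k
    have hsb := sum_eq_coreTowerSize_add hb k
    rw [hbl, sameCores_zero_iff.1 hb0] at hsb
    rw [hw] at hsl hsb
    have hcn := coreTowerSize_nonneg k lam
    rcases Nat.eq_zero_or_pos w with rfl | hw0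
    · have hl0 := towerRow_eq_of_rowSize_eq_zero hl hw
      rw [eq_of_towerRow_eq hl hk hlk (hl0.trans hk0.symm),
        eq_of_towerRow_eq hb isPart_zero hb0 (hbl.trans hl0), degParity_zero, mul_one]
    · have hpow : (2 : ℤ) ^ k ≤ 2 ^ k * w := le_mul_of_one_le_right (by positivity) (by omega)
      have hlk2 : 2 ^ k ≤ lam.sum := by
        have : (2 : ℤ) ^ k ≤ lam.sum := by omega
        exact_mod_cast this
      have hbk2 : 2 ^ k ≤ be.sum := by
        have : (2 : ℤ) ^ k ≤ be.sum := by omega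
        exact_mod_cast this
      have hpos : 0 < 2 ^ k := by positivity
      have hiff : ∀ {al nu : Multiset ℕ}, IsPart al → IsPart nu → (nu ∈ hookSet (2 ^ k) al ↔
          SameCores k al nu ∧ RowHook 1 (towerRow k al) (towerRow k nu)) := by
        intro al nu hal hnu
        rw [← isHookRemoval_iff hpos hal, ← isHookRemoval_two_pow_mul one_pos hal hnu, mul_one]
      have hex : ∀ al mu : Multiset ℕ, IsPart mu →
          ∃ nu, IsPart nu ∧ SameCores k nu al ∧ towerRow k nu = towerRow k mu :=
        fun al mu hmu =>
          exists_towerRow_eq k al (isPartRow_towerRow hmu k) (length_towerRow k mu)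
      choose! f hf1 hf2 hf3 using hex
      rw [degParity_eq_sum_hookSet k hl hlk2, degParity_eq_sum_hookSet k hb hbk2, Finset.mul_sum]
      refine Finset.sum_bij (fun mu _ => f 0 mu) ?_ ?_ ?_ ?_
      · intro mu hmu
        have hmup := pos_of_mem_hookSet hmu
        have h := (hiff hl hmup).1 hmu
        rw [hiff hb (hf1 0 mu hmup), hf3 0 mu hmup, hbl]
        exact ⟨hb0.trans (hf2 0 mu hmup).symm, h.2⟩
      · intro mu hmu nu hnu heq
        have hmup := pos_of_mem_hookSet hmu
        have hnup := pos_of_mem_hookSet hnu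
        refine eq_of_towerRow_eq (k := k) hmup hnup
          (((hiff hl hmup).1 hmu).1.symm.trans ((hiff hl hnup).1 hnu).1) ?_
        rw [← hf3 0 mu hmup, ← hf3 0 nu hnup, heq]
      · intro nu hnu
        have hnup := pos_of_mem_hookSet hnu
        have h := (hiff hb hnup).1 hnu
        have hlp := hf1 lam nu hnup
        refine ⟨f lam nu, ?_, ?_⟩
        · rw [hiff hl hlp, hf3 lam nu hnup, ← hbl]
          exact ⟨(hf2 lam nu hnup).symm, h.2⟩
        · refine eq_of_towerRow_eq (k := k) (hf1 0 _ hlp) hnup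
            ((hf2 0 _ hlp).trans (hb0.symm.trans h.1)) ?_
          rw [hf3 0 _ hlp, hf3 lam nu hnup]
      · intro mu hmu
        have hmup := pos_of_mem_hookSet hmu
        have h := (hiff hl hmup).1 hmu
        have hsz := h.2.rowSize_add
        exact ih _ (by omega) hmup (hf1 0 mu hmup) (h.1.symm.trans hlk) (hf2 0 mu hmup)
          (hf3 0 mu hmup) rfl

lemma towerRow_eq_zero_of_sum_lt {k : ℕ} {ka : Multiset ℕ} (hk : IsPart ka)
    (h : ka.sum < 2 ^ k) : towerRow k ka = towerRow k 0 := by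
  refine towerRow_eq_of_rowSize_eq_zero hk ?_
  by_contra hne
  have h1 := sum_eq_coreTowerSize_add hk k
  have h2 := coreTowerSize_nonneg k ka
  have h3 : (2 : ℤ) ^ k ≤ 2 ^ k * rowSize (towerRow k ka) :=
    le_mul_of_one_le_right (by positivity) (by omega)
  have h4 : (ka.sum : ℤ) < 2 ^ k := by exact_mod_cast h
  omega

lemma sum_lt_of_towerRow_eq_zero {k : ℕ} {ka : Multiset ℕ} (hk : OddP ka)
    (h : towerRow k ka = towerRow k 0) : ka.sum < 2 ^ k := by
  by_contra! hle
  obtain ⟨hh, hodd⟩ := fkOp_spec hk hle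
  rw [← mul_one (2 ^ k), isHookRemoval_two_pow_mul one_pos hk.1 hodd.1, h] at hh
  have := hh.2.rowSize_add
  rw [rowSize_towerRow_zero] at this
  omega

/-- Splitting an odd partition along the rows of its 2-core tower. -/
lemma OddP.exists_split {k : ℕ} {lam : Multiset ℕ} (hl : OddP lam) :
    ∃ ka be, OddP ka ∧ OddP be ∧ SameCores k lam ka ∧ towerRow k ka = towerRow k 0 ∧
      SameCores k be 0 ∧ towerRow k be = towerRow k lam := by
  obtain ⟨ka, hk, hkl, hk0⟩ := exists_towerRow_eq k lam
    (isPartRow_towerRow isPart_zero k) (length_towerRow k 0)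
  obtain ⟨be, hb, hb0, hbl⟩ := exists_towerRow_eq k 0
    (isPartRow_towerRow hl.1 k) (length_towerRow k lam)
  have h := degParity_eq_mul hl.1 hk hb hkl.symm hk0 hb0 hbl
  rw [(oddP_iff.1 hl).2] at h
  refine ⟨ka, be, oddP_iff.2 ⟨hk, ?_⟩, oddP_iff.2 ⟨hb, ?_⟩, hkl.symm, hk0, hb0, hbl⟩
  · exact zmod_two_eq_one fun h0 => by simp [h0] at h
  · exact zmod_two_eq_one fun h0 => by simp [h0] at h

lemma OddP.coreTowerSize_lt {k : ℕ} {lam : Multiset ℕ} (hl : OddP lam) :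
    coreTowerSize k lam < 2 ^ k := by
  obtain ⟨ka, be, hk, -, hlk, hk0, -, -⟩ := hl.exists_split (k := k)
  have h1 : (ka.sum : ℤ) < 2 ^ k := by exact_mod_cast sum_lt_of_towerRow_eq_zero hk hk0
  have h2 := sum_eq_coreTowerSize_add hk.1 k
  rw [hk0, rowSize_towerRow_zero, ← hlk.coreTowerSize_eq] at h2
  simp only [Nat.cast_zero, mul_zero, add_zero] at h2
  omega

lemma OddP.coreTowerSize_eq {k w m : ℕ} {lam : Multiset ℕ} (hl : OddP lam) (hm : m < 2 ^ k)
    (h : lam.sum = 2 ^ k * w + m) : coreTowerSize k lam = m ∧ rowSize (towerRow k lam) = w := by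
  have h1 := hl.coreTowerSize_lt (k := k)
  have h2 := sum_eq_coreTowerSize_add hl.1 k
  obtain ⟨c, hc⟩ := Int.eq_ofNat_of_zero_le (coreTowerSize_nonneg k lam)
  rw [hc] at h1 h2 ⊢
  rw [h] at h2
  norm_cast at h1 h2 ⊢
  generalize rowSize (towerRow k lam) = w' at *
  have hpos : 0 < 2 ^ k := by positivity
  have e1 := congrArg (· % 2 ^ k) h2
  have e2 := congrArg (· / 2 ^ k) h2
  simp only [Nat.mul_add_mod, Nat.add_mul_mod_self_left, Nat.mod_eq_of_lt hm,
    Nat.mod_eq_of_lt h1] at e1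
  simp only [Nat.mul_add_div hpos, Nat.add_mul_div_left _ _ hpos, Nat.div_eq_of_lt hm,
    Nat.div_eq_of_lt h1] at e2
  omega

/-- The maps `f_j`, `k ≤ j`, do not depend on the first `k` rows of the 2-core tower. -/
lemma fkOp_compat {k j : ℕ} (hkj : k ≤ j) {lam be : Multiset ℕ} (hl : OddP lam) (hb : OddP be)
    (hb0 : SameCores k be 0) (hbl : towerRow k be = towerRow k lam) (hj : 2 ^ j ≤ be.sum) :
    OddP (fkOp j lam) ∧ OddP (fkOp j be) ∧ SameCores k (fkOp j lam) lam ∧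
      SameCores k (fkOp j be) 0 ∧ towerRow k (fkOp j be) = towerRow k (fkOp j lam) ∧
      (fkOp j be).sum + 2 ^ j = be.sum := by
  have hsl := sum_eq_coreTowerSize_add hl.1 k
  have hsb := sum_eq_coreTowerSize_add hb.1 k
  rw [hbl, sameCores_zero_iff.1 hb0] at hsb
  have hcn := coreTowerSize_nonneg k lam
  have hjl : 2 ^ j ≤ lam.sum := by omega
  obtain ⟨hh, hodd⟩ := fkOp_spec hb hj
  have hsum := sum_of_mem_hookSet hb.1 ((isHookRemoval_iff (by positivity) hb.1).1 hh)
  obtain ⟨i, rfl⟩ := Nat.exists_eq_add_of_le hkj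
  have hpos : 0 < 2 ^ i := by positivity
  obtain ⟨mu, hmu, hmul, hmur⟩ := exists_towerRow_eq k lam
    (isPartRow_towerRow hodd.1 k) (length_towerRow k _)
  have hh' := hh
  rw [pow_add, isHookRemoval_two_pow_mul hpos hb.1 hodd.1] at hh'
  have hnu0 := hh'.1.symm.trans hb0
  have hmuh : IsHookRemoval (2 ^ (k + i)) lam mu := by
    rw [pow_add, isHookRemoval_two_pow_mul hpos hl.1 hmu, hmur, ← hbl]
    exact ⟨hmul.symm, hh'.2⟩
  obtain ⟨ka, -, hk, -, hlk, hk0, -, -⟩ := hl.exists_split (k := k)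
  have hmuo : OddP mu := by
    refine oddP_iff.2 ⟨hmu, ?_⟩
    rw [degParity_eq_mul hmu hk.1 hodd.1 (hmul.trans hlk) hk0 hnu0 hmur.symm,
      (oddP_iff.1 hk).2, (oddP_iff.1 hodd).2, mul_one]
  rw [← eq_fkOp hl hjl hmuh hmuo]
  exact ⟨hmuo, hodd, hmul, hnu0, hmur.symm, hsum⟩

lemma fkOp_fkOp_eq_iff {k : ℕ} {lam be : Multiset ℕ} (hl : OddP lam) (hb : OddP be)
    (hb0 : SameCores k be 0) (hbl : towerRow k be = towerRow k lam) (hk : 2 ^ (k + 1) ≤ be.sum) :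
    fkOp k (fkOp k lam) = fkOp (k + 1) lam ↔ fkOp k (fkOp k be) = fkOp (k + 1) be := by
  have hpow : 2 ^ (k + 1) = 2 ^ k + 2 ^ k := by ring
  obtain ⟨h1, h2, h3, h4, h5, h6⟩ := fkOp_compat le_rfl hl hb hb0 hbl (j := k) (by omega)
  obtain ⟨i1, i2, i3, i4, i5, -⟩ := fkOp_compat le_rfl h1 h2 h4 h5 (by omega)
  obtain ⟨j1, j2, j3, j4, j5, -⟩ := fkOp_compat (Nat.le_succ k) hl hb hb0 hbl hk
  constructor
  · intro h
    refine eq_of_towerRow_eq i2.1 j2.1 (i4.trans j4.symm) ?_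
    rw [i5, j5, h]
  · intro h
    refine eq_of_towerRow_eq i1.1 j1.1 ((i3.trans h3).trans j3.symm) ?_
    rw [← i5, ← j5, h]

/-- Counting odd partitions with a property depending only on the rows of the 2-core tower
from row `k` on. -/
lemma ncard_odd_split {k w m : ℕ} (hm : m < 2 ^ k) {P : Multiset ℕ → Prop}
    (hP : ∀ lam be, OddP lam → OddP be → be.sum = 2 ^ k * w → SameCores k be 0 →
      towerRow k be = towerRow k lam → (P lam ↔ P be)) :
    {lam | OddP lam ∧ lam.sum = 2 ^ k * w + m ∧ P lam}.ncard =
      {ka | OddP ka ∧ ka.sum = m}.ncard * {be | OddP be ∧ be.sum = 2 ^ k * w ∧ P be}.ncard := by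
  have hex : ∀ ka be : Multiset ℕ, IsPart be →
      ∃ lam, IsPart lam ∧ SameCores k lam ka ∧ towerRow k lam = towerRow k be :=
    fun ka be hbe => exists_towerRow_eq k ka (isPartRow_towerRow hbe k) (length_towerRow k be)
  choose! g hg1 hg2 hg3 using hex
  have hb0 : ∀ be, OddP be → be.sum = 2 ^ k * w → SameCores k be 0 := fun be hb hs => by
    rw [sameCores_zero_iff]
    exact_mod_cast (hb.coreTowerSize_eq (k := k) (m := 0) (by positivity) hs).1
  rw [← Set.ncard_prod]
  symm
  refine Set.ncard_congr (fun p _ => g p.1 p.2) ?_ ?_ ?_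
  · rintro ⟨ka, be⟩ ⟨⟨hk, hks⟩, hb, hbs, hPb⟩
    dsimp only at *
    have h1 := hg1 ka be hb.1
    have h2 := hg2 ka be hb.1
    have h3 := hg3 ka be hb.1
    have hk0 := towerRow_eq_zero_of_sum_lt hk.1 (k := k) (by omega)
    have hodd : OddP (g ka be) := by
      refine oddP_iff.2 ⟨h1, ?_⟩
      rw [degParity_eq_mul h1 hk.1 hb.1 h2 hk0 (hb0 be hb hbs) h3.symm,
        (oddP_iff.1 hk).2, (oddP_iff.1 hb).2, mul_one]
    refine ⟨hodd, ?_, (hP _ _ hodd hb hbs (hb0 be hb hbs) h3.symm).2 hPb⟩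
    have e1 := sum_eq_coreTowerSize_add h1 k
    have e2 := sum_eq_coreTowerSize_add hk.1 k
    have e3 := sum_eq_coreTowerSize_add hb.1 k
    rw [sameCores_zero_iff.1 (hb0 be hb hbs)] at e3
    rw [hk0, rowSize_towerRow_zero, ← h2.coreTowerSize_eq] at e2
    rw [h3] at e1
    simp only [Nat.cast_zero, mul_zero, add_zero] at e2
    omega
  · rintro ⟨ka, be⟩ ⟨ka', be'⟩ ⟨⟨hk, hks⟩, hb, hbs, -⟩ ⟨⟨hk', hks'⟩, hb', hbs', -⟩ heq
    dsimp only at *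
    have hk0 := towerRow_eq_zero_of_sum_lt hk.1 (k := k) (by omega)
    have hk0' := towerRow_eq_zero_of_sum_lt hk'.1 (k := k) (by omega)
    have h2 := hg2 ka be hb.1
    have h3 := hg3 ka be hb.1
    rw [heq] at h2 h3
    rw [eq_of_towerRow_eq hk.1 hk'.1 (h2.symm.trans (hg2 ka' be' hb'.1)) (hk0.trans hk0'.symm),
      eq_of_towerRow_eq hb.1 hb'.1 ((hb0 be hb hbs).trans (hb0 be' hb' hbs').symm)
        (h3.symm.trans (hg3 ka' be' hb'.1))]
  · rintro lam ⟨hl, hls, hPl⟩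
    obtain ⟨ka, be, hk, hb, hlk, hk0, hbe0, hbl⟩ := hl.exists_split (k := k)
    obtain ⟨hc, hr⟩ := hl.coreTowerSize_eq hm hls
    have e2 := sum_eq_coreTowerSize_add hk.1 k
    have e3 := sum_eq_coreTowerSize_add hb.1 k
    rw [hk0, rowSize_towerRow_zero, ← hlk.coreTowerSize_eq, hc] at e2
    rw [sameCores_zero_iff.1 hbe0, hbl, hr] at e3
    simp only [Nat.cast_zero, mul_zero, add_zero, zero_add] at e2 e3
    have hbs : be.sum = 2 ^ k * w := by exact_mod_cast e3
    refine ⟨(ka, be), ⟨⟨hk, by exact_mod_cast e2⟩, hb, hbs,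
      (hP lam be hl hb hbs hbe0 hbl).1 hPl⟩, ?_⟩
    exact eq_of_towerRow_eq (hg1 ka be hb.1) hl.1 ((hg2 ka be hb.1).trans hlk.symm)
      ((hg3 ka be hb.1).trans hbl)

/-- The beta-set of the hook of size `N` with `N` beads obtained from the empty partition by
moving bead `x` up by `N`. -/
def hookBeta (N x : ℕ) : Finset ℕ := insert (x + N) ((Finset.range N).erase x)

lemma card_hookBeta {N x : ℕ} (hx : x < N) : (hookBeta N x).card = N := by
  rw [hookBeta, Finset.card_insert_of_notMem (by simp),
    Finset.card_erase_add_one (Finset.mem_range.2 hx), Finset.card_range]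

lemma hookBeta_move {N x : ℕ} (hx : x < N) :
    x + N ∈ moves N (hookBeta N x) ∧ mv N (hookBeta N x) (x + N) = Finset.range N := by
  constructor
  · rw [mem_moves, Nat.add_sub_cancel]
    refine ⟨by simp [hookBeta], by omega, ?_⟩
    simp only [hookBeta, Finset.mem_insert, Finset.mem_erase]
    omega
  · ext y
    rw [mem_mv, Nat.add_sub_cancel]
    simp only [hookBeta, Finset.mem_insert, Finset.mem_erase, Finset.mem_range]
    omega

lemma card_le_sum {lam : Multiset ℕ} (hl : IsPart lam) : Multiset.card lam ≤ lam.sum := by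
  simpa using Multiset.card_nsmul_le_sum (s := lam) (a := 1) hl

lemma oddP_of_zero_mem_hookSet {b : ℕ} {lam : Multiset ℕ} (hl : IsPart lam)
    (hs : lam.sum = 2 ^ b) (h : 0 ∈ hookSet (2 ^ b) lam) : OddP lam := by
  have hset : hookSet (2 ^ b) lam = {0} := by
    refine Finset.eq_singleton_iff_unique_mem.2 ⟨h, fun mu hmu => ?_⟩
    have := sum_of_mem_hookSet hl hmu
    exact eq_zero_of_sum_eq_zero (pos_of_mem_hookSet hmu) (by omega)
  rw [oddP_iff, degParity_eq_sum_hookSet b hl hs.ge, hset, Finset.sum_singleton]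
  exact ⟨hl, degParity_zero⟩

lemma ncard_odd_two_pow (b : ℕ) : {lam | OddP lam ∧ lam.sum = 2 ^ b}.ncard = 2 ^ b := by
  have hpos : 0 < 2 ^ b := by positivity
  conv_rhs => rw [← Finset.card_range (2 ^ b), ← Set.ncard_coe_finset]
  symm
  refine Set.ncard_congr (fun x _ => partOfBeta (hookBeta (2 ^ b) x)) ?_ ?_ ?_
  · intro x hx
    have hx : x < 2 ^ b := by simpa using hx
    obtain ⟨h1, h2⟩ := hookBeta_move hx
    have hs := sum_partOfBeta_mv h1
    rw [h2, partOfBeta_range, Multiset.sum_zero, zero_add] at hs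
    refine ⟨oddP_of_zero_mem_hookSet (partOfBeta_pos _) hs.symm ?_, hs.symm⟩
    rw [hookSet_partOfBeta, Finset.mem_image]
    exact ⟨_, h1, by rw [h2, partOfBeta_range]⟩
  · intro x y hx hy h
    have hx : x < 2 ^ b := by simpa using hx
    have hy : y < 2 ^ b := by simpa using hy
    have heq := partOfBeta_injective (by rw [card_hookBeta hx, card_hookBeta hy]) h
    by_contra hne
    have hmem : x ∈ hookBeta (2 ^ b) y := by simp [hookBeta, hx, hne]
    rw [← heq] at hmem
    simp only [hookBeta, Finset.mem_insert, Finset.mem_erase] at hmem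
    omega
  · rintro lam ⟨hl, hs⟩
    obtain ⟨hh, hodd⟩ := fkOp_spec hl hs.ge
    have hsum := hs ▸ sum_of_mem_hookSet hl.1 ((isHookRemoval_iff hpos hl.1).1 hh)
    rw [isHookRemoval_iff hpos hl.1, eq_zero_of_sum_eq_zero hodd.1 (by omega)] at hh
    have hcard := hs ▸ card_le_sum hl.1
    obtain ⟨x, hx, h0⟩ := (mem_hookSet_iff hcard).1 hh
    have hcb := card_betaSet lam _ hcard
    have hr := partOfBeta_injective (by rw [card_mv hx, hcb, Finset.card_range])
      (h0.trans (partOfBeta_range (2 ^ b)).symm)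
    have hxm := mem_moves.1 hx
    obtain ⟨y, rfl⟩ := Nat.exists_eq_add_of_le' hxm.2.1
    have hy : y < 2 ^ b := by
      rw [← Finset.mem_range, ← hr, mem_mv]
      left
      omega
    refine ⟨y, by simpa using hy, ?_⟩
    have hS : hookBeta (2 ^ b) y = betaSet lam (2 ^ b) := by
      rw [hookBeta, ← hr]
      ext z
      rw [Nat.add_sub_cancel] at hxm
      simp only [Finset.mem_insert, Finset.mem_erase, mem_mv, Nat.add_sub_cancel]
      grind
    rw [hS, partOfBeta_betaSet hl.1 hcard]

lemma ncard_odd_sum_two_pow (s : Finset ℕ) :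
    {lam | OddP lam ∧ lam.sum = ∑ i ∈ s, 2 ^ i}.ncard = ∏ i ∈ s, 2 ^ i := by
  induction s using Finset.induction_on_max with
  | empty =>
    rw [Finset.sum_empty, Finset.prod_empty, Set.ncard_eq_one]
    refine ⟨0, Set.eq_singleton_iff_unique_mem.2 ⟨⟨?_, rfl⟩, ?_⟩⟩
    · exact oddP_iff.2 ⟨isPart_zero, degParity_zero⟩
    · exact fun lam h => eq_zero_of_sum_eq_zero h.1.1 h.2
  | insert b s hb ih =>
    have hnot : b ∉ s := fun h => (hb b h).ne rfl
    have := ncard_odd_split (k := b) (w := 1) (Nat.geomSum_lt le_rfl hb) (P := fun _ => True)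
      (fun _ _ _ _ _ _ _ => Iff.rfl)
    simp only [and_true, mul_one] at this
    rw [Finset.sum_insert hnot, Finset.prod_insert hnot, this, ih, ncard_odd_two_pow, mul_comm]

theorem stmt7 (k n r : ℕ) (hkn : 2 ^ (k + 1) ≤ n) (a : ℕ → ℕ)
    (hdec : ∀ i j, 1 ≤ i → i < j → j ≤ r → a j < a i)
    (hn : n = ∑ i ∈ Finset.Icc 1 r, 2 ^ a i)
    (q : ℕ) (hq : q ∈ Finset.Icc 1 r) (haq : k ≤ a q)
    (hqmax : ∀ i ∈ Finset.Icc 1 r, k ≤ a i → i ≤ q) :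
    (∀ τ : List ℕ, τ.length = 2 ^ k → τ.sum = n / 2 ^ k →
      GnumT k n τ = (∏ j ∈ Finset.Icc (q + 1) r, 2 ^ a j) *
        GnumT k (∑ i ∈ Finset.Icc 1 q, 2 ^ a i) τ) ∧
    Gnum k n = (∏ j ∈ Finset.Icc (q + 1) r, 2 ^ a j) *
      Gnum k (∑ i ∈ Finset.Icc 1 q, 2 ^ a i) := by
  rw [Finset.mem_Icc] at hq
  have hinj : Set.InjOn a (Finset.Icc (q + 1) r) := by
    intro i hi j hj hij
    rw [Finset.mem_coe, Finset.mem_Icc] at hi hj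
    rcases lt_trichotomy i j with h | h | h
    · have := hdec i j (by omega) h hj.2
      omega
    · exact h
    · have := hdec j i (by omega) h hi.2
      omega
  have hprod : {ka : Multiset ℕ | OddP ka ∧ ka.sum = ∑ j ∈ Finset.Icc (q + 1) r, 2 ^ a j}.ncard =
      ∏ j ∈ Finset.Icc (q + 1) r, 2 ^ a j := by
    have := ncard_odd_sum_two_pow ((Finset.Icc (q + 1) r).image a)
    rwa [Finset.sum_image hinj, Finset.prod_image hinj] at this
  have hm : ∑ j ∈ Finset.Icc (q + 1) r, 2 ^ a j < 2 ^ k := by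
    rw [← Finset.sum_image (f := fun i => 2 ^ i) hinj]
    refine Nat.geomSum_lt le_rfl fun i hi => ?_
    obtain ⟨j, hj, rfl⟩ := Finset.mem_image.1 hi
    rw [Finset.mem_Icc] at hj
    by_contra! hle
    have := hqmax j (Finset.mem_Icc.2 ⟨by omega, hj.2⟩) hle
    omega
  obtain ⟨w, hw⟩ : 2 ^ k ∣ ∑ i ∈ Finset.Icc 1 q, 2 ^ a i := by
    refine Finset.dvd_sum fun i hi => pow_dvd_pow 2 ?_
    rw [Finset.mem_Icc] at hi
    rcases hi.2.eq_or_lt with rfl | h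
    · exact haq
    · have := hdec i q hi.1 h hq.2
      omega
  have hsplit : n = 2 ^ k * w + ∑ j ∈ Finset.Icc (q + 1) r, 2 ^ a j := by
    have hu : Finset.Icc 1 r = Finset.Icc 1 q ∪ Finset.Icc (q + 1) r := by
      ext i
      simp only [Finset.mem_union, Finset.mem_Icc]
      omega
    have hd : Disjoint (Finset.Icc 1 q) (Finset.Icc (q + 1) r) := by
      rw [Finset.disjoint_left]
      intro i hi hi'
      rw [Finset.mem_Icc] at hi hi'
      omega
    rw [hn, hu, Finset.sum_union hd, hw]
  have hw2 : 2 ^ (k + 1) ≤ 2 ^ k * w := by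
    rw [pow_succ] at hkn ⊢
    refine Nat.mul_le_mul_left _ ?_
    by_contra! hlt
    have : 2 ^ k * w ≤ 2 ^ k * 1 := Nat.mul_le_mul_left _ (by omega)
    omega
  rw [hw, ← hprod, hsplit]
  constructor
  · intro τ _ _
    exact ncard_odd_split (P := fun lam => (towerRow k lam).map Multiset.sum = τ ∧
      fkOp k (fkOp k lam) = fkOp (k + 1) lam) hm fun lam be hl hb hbs hb0 hbl => by
        rw [hbl, fkOp_fkOp_eq_iff hl hb hb0 hbl (hbs ▸ hw2)]
  · exact ncard_odd_split (P := fun lam => fkOp k (fkOp k lam) = fkOp (k + 1) lam) hm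
      fun lam be hl hb hbs hb0 hbl => fkOp_fkOp_eq_iff hl hb hb0 hbl (hbs ▸ hw2)

end OddSym
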